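/- arXiv:2210.16550 — 7 statements merged into one kernel-verified Lean document; each statement's English description precedes it below -/
import Mathlib

section
/- Let (Ω,𝓕,P) be a probability space carrying real random variables U0, U1, a random variable N_T uniform on [0,1], and a random variable A with values in a countable set 𝒜 such that A is independent of the triple (U0,U1,N_T). For each a ∈ 𝒜 let T^a := g(U0,U1,N_T,a) for jointly measurable g : ℝ×ℝ×[0,1]×𝒜 → [0,∞), and define T := T^A pointwise. Then: (i) for every a ∈ 𝒜, every t ≥ 0 with P(T^a ≥ t) > 0, every Borel set B ⊆ [0,∞) and every a' ∈ 𝒜, one has P(T^a ∈ B, A = a' | T^a ≥ t) = P(T^a ∈ B | T^a ≥ t)·P(A = a') (conditionally on its own survival, the potential outcome remains independent of the exposure); and (ii) whenever additionally P(A = a) > 0, for all t, h > 0 one has P(T ∈ [t,t+h) | T ≥ t, A = a) = P(T^a ∈ [t,t+h) | T^a ≥ t), i.e., the observed hazard ratio from a randomized trial equals the marginal causal hazard ratio. -/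
open MeasureTheory Real Set Filter Topology

/-- (i) conditionally on its own survival `T^a ≥ t`, the potential outcome
remains independent of the randomized exposure `A`; (ii) the observed hazard from a
randomized trial equals the marginal causal hazard of the potential outcome. -/
theorem potential_outcome_independence_given_own_survival
    {Ω : Type*} [MeasurableSpace Ω] (P : Measure Ω) [IsProbabilityMeasure P]
    {𝒜 : Type*} [MeasurableSpace 𝒜] [MeasurableSingletonClass 𝒜] [Countable 𝒜]
    (U0 U1 NT : Ω → ℝ) (hU0 : Measurable U0) (hU1 : Measurable U1) (hNT : Measurable NT)
    (hNTunif : P.map NT = volume.restrict (Set.Icc (0:ℝ) 1))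
    (A : Ω → 𝒜) (hA : Measurable A)
    (hindep : ProbabilityTheory.IndepFun A (fun ω => (U0 ω, U1 ω, NT ω)) P)
    (g : ℝ × ℝ × ℝ × 𝒜 → ℝ) (hg : Measurable g) (hgnn : ∀ p, 0 ≤ g p)
    (Tpot : 𝒜 → Ω → ℝ) (hTpot : ∀ a ω, Tpot a ω = g (U0 ω, U1 ω, NT ω, a))
    (T : Ω → ℝ) (hT : ∀ ω, T ω = g (U0 ω, U1 ω, NT ω, A ω)) :
    (∀ (a : 𝒜) (t : ℝ), 0 ≤ t → 0 < P {ω | t ≤ Tpot a ω} →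
      ∀ B : Set ℝ, MeasurableSet B → ∀ a' : 𝒜,
        (ProbabilityTheory.cond P {ω | t ≤ Tpot a ω}) {ω | Tpot a ω ∈ B ∧ A ω = a'}
          = (ProbabilityTheory.cond P {ω | t ≤ Tpot a ω}) {ω | Tpot a ω ∈ B}
              * P {ω | A ω = a'}) ∧
    (∀ a : 𝒜, 0 < P {ω | A ω = a} → ∀ t h : ℝ, 0 < t → 0 < h →
      (ProbabilityTheory.cond P {ω | t ≤ T ω ∧ A ω = a}) {ω | T ω ∈ Ico t (t + h)}
        = (ProbabilityTheory.cond P {ω | t ≤ Tpot a ω})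
            {ω | Tpot a ω ∈ Ico t (t + h)}) := by
  have hTm : ∀ a, Measurable (Tpot a) := by
    intro a
    have : Tpot a = fun ω => g (U0 ω, U1 ω, NT ω, a) := funext (hTpot a)
    rw [this]
    exact hg.comp (hU0.prodMk (hU1.prodMk (hNT.prodMk measurable_const)))
  have key : ∀ (a a' : 𝒜) (B : Set ℝ), MeasurableSet B →
      P (Tpot a ⁻¹' B ∩ A ⁻¹' {a'}) = P (Tpot a ⁻¹' B) * P (A ⁻¹' {a'}) := by
    intro a a' B hB
    have hφ : Measurable (fun p : ℝ × ℝ × ℝ => g (p.1, p.2.1, p.2.2, a)) := by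
      apply hg.comp
      fun_prop
    have h2 : ProbabilityTheory.IndepFun A (Tpot a) P := by
      have h3 := hindep.comp measurable_id hφ
      have : Tpot a = (fun p : ℝ × ℝ × ℝ => g (p.1, p.2.1, p.2.2, a)) ∘
          (fun ω => (U0 ω, U1 ω, NT ω)) := funext (hTpot a)
      rw [this]
      exact h3
    have h4 := h2.measure_inter_preimage_eq_mul {a'} B (measurableSet_singleton a') hB
    rw [inter_comm, h4, mul_comm]
  have hS : ∀ (a : 𝒜) (t : ℝ), MeasurableSet {ω | t ≤ Tpot a ω} := fun a t =>
    measurableSet_le measurable_const (hTm a)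
  refine ⟨?_, ?_⟩
  · intro a t _ _ B hB a'
    rw [ProbabilityTheory.cond_apply (hS a t), ProbabilityTheory.cond_apply (hS a t)]
    have e1 : {ω | t ≤ Tpot a ω} ∩ {ω | Tpot a ω ∈ B ∧ A ω = a'}
        = Tpot a ⁻¹' (Ici t ∩ B) ∩ A ⁻¹' {a'} := by
      ext ω; simp [and_assoc]
    have e2 : {ω | t ≤ Tpot a ω} ∩ {ω | Tpot a ω ∈ B} = Tpot a ⁻¹' (Ici t ∩ B) := rfl
    have e3 : {ω | A ω = a'} = A ⁻¹' {a'} := rfl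
    rw [e1, e2, e3, key a a' _ (measurableSet_Ici.inter hB), mul_assoc]
  · intro a ha t h _ _
    have e0 : {ω | t ≤ T ω ∧ A ω = a} = Tpot a ⁻¹' (Ici t) ∩ A ⁻¹' {a} := by
      ext ω
      simp only [mem_setOf_eq, mem_inter_iff, mem_preimage, mem_Ici, mem_singleton_iff, hT, hTpot]
      constructor <;> rintro ⟨h1, rfl⟩ <;> exact ⟨h1, rfl⟩
    have e1 : (Tpot a ⁻¹' (Ici t) ∩ A ⁻¹' {a}) ∩ {ω | T ω ∈ Ico t (t + h)}
        = Tpot a ⁻¹' (Ici t ∩ Ico t (t + h)) ∩ A ⁻¹' {a} := by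
      ext ω
      simp only [mem_setOf_eq, mem_inter_iff, mem_preimage, mem_singleton_iff, hT, hTpot]
      constructor
      · rintro ⟨⟨h1, rfl⟩, h2⟩
        exact ⟨⟨h1, h2⟩, rfl⟩
      · rintro ⟨⟨h1, h2⟩, rfl⟩
        exact ⟨⟨h1, rfl⟩, h2⟩
    have e2 : {ω | t ≤ Tpot a ω} ∩ {ω | Tpot a ω ∈ Ico t (t + h)}
        = Tpot a ⁻¹' (Ici t ∩ Ico t (t + h)) := rfl
    have e3 : {ω | t ≤ Tpot a ω} = Tpot a ⁻¹' (Ici t) := rfl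
    have hm : MeasurableSet (Tpot a ⁻¹' (Ici t) ∩ A ⁻¹' {a}) :=
      (hS a t).inter (hA (measurableSet_singleton a))
    have hp0 : P (A ⁻¹' {a}) ≠ 0 := ha.ne'
    have hp1 : P (A ⁻¹' {a}) ≠ ⊤ := measure_ne_top _ _
    rw [e0, ProbabilityTheory.cond_apply hm, ProbabilityTheory.cond_apply (hS a t), e1, e2, e3,
      key a a _ measurableSet_Ici, key a a _ (measurableSet_Ici.inter measurableSet_Ico),
      ENNReal.mul_inv (Or.inr hp1) (Or.inr hp0), mul_mul_mul_comm, ENNReal.inv_mul_cancel hp0 hp1,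
      mul_one]
end

section
/- Fix t > 0. Let U0, U1 be real random variables, let f0 : [0,∞)×ℝ → [0,∞) and f1 : [0,∞)×ℝ → [0,∞) be measurable, and set Λ^a(s,u0,u1) = ∫_0^s f0(r,u0)f1(r,u1) dr and Λ^0(s,u0) = ∫_0^s f0(r,u0) dr. Let T^a be a nonnegative random variable whose conditional survival given (U0,U1) is exp(−Λ^a(s,U0,U1)), and T^0 one whose conditional survival given U0 is exp(−Λ^0(s,U0)). Assume that for each (u0,u1) the maps s ↦ f0(s,u0)f1(s,u1) and s ↦ f0(s,u0) are nondecreasing and continuous on a right neighbourhood [t, t+h̃] of t, that the no-infinite-discontinuity condition holds (for all h ∈ (0,h̃): E[f0(t+h,U0)f1(t+h,U1)·1{T^a ≥ t}] < ∞ and E[f0(t+h,U0)·1{T^0 ≥ t}] < ∞), and that P(T^a ≥ t) > 0, P(T^0 ≥ t) > 0 and E[f0(t,U0)·exp(−Λ^0(t,U0))] > 0. Then the marginal hazards λ_{T^a}(t) and λ_{T^0}(t) exist and their ratio satisfies λ_{T^a}(t)/λ_{T^0}(t) = E[f0(t,U0)f1(t,U1) | T^a ≥ t] / E[f0(t,U0)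 | T^0 ≥ t] = (E[f0(t,U0)f1(t,U1)·exp(−Λ^a(t,U0,U1))]/E[exp(−Λ^a(t,U0,U1))]) ÷ (E[f0(t,U0)·exp(−Λ^0(t,U0))]/E[exp(−Λ^0(t,U0))]). -/
open MeasureTheory Real Set Filter Topology

theorem hazard_aux {Ω E : Type*} [MeasurableSpace Ω] [MeasurableSpace E]
    (P : Measure Ω) [IsProbabilityMeasure P]
    (U : Ω → E) (hU : Measurable U) (T : Ω → ℝ) (hT : Measurable T)
    (g : ℝ → E → ℝ) (hg : Measurable (Function.uncurry g)) (hgnn : ∀ s u, 0 ≤ g s u)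
    (Λ : ℝ → E → ℝ) (hΛ : ∀ s u, Λ s u = ∫ r in (0:ℝ)..s, g r u)
    (hsurv : ∀ s : ℝ, 0 ≤ s → ∀ B : Set E, MeasurableSet B →
      (P {ω | s ≤ T ω ∧ U ω ∈ B}).toReal
        = ∫ ω, B.indicator (fun _ => (1:ℝ)) (U ω) * Real.exp (-(Λ s (U ω))) ∂P)
    (t : ℝ) (ht : 0 < t) (k : ℝ) (hk : 0 < k)
    (hmono : ∀ u, MonotoneOn (fun s => g s u) (Icc t (t + k)))
    (hcont : ∀ u, ContinuousOn (fun s => g s u) (Icc t (t + k)))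
    (hint : ∀ h : ℝ, h ∈ Ioo 0 k →
      ∫⁻ ω in {ω | t ≤ T ω}, ENNReal.ofReal (g (t + h) (U ω)) ∂P < ⊤) :
    ∃ L : ℝ,
      Tendsto
        (fun h : ℝ => h⁻¹ * ((ProbabilityTheory.cond P {ω | t ≤ T ω})
            {ω | T ω ∈ Ico t (t + h)}).toReal)
        (𝓝[>] 0) (𝓝 L) ∧
      L = (∫ ω in {ω | t ≤ T ω}, g t (U ω) ∂P) / (P {ω | t ≤ T ω}).toReal ∧
      L = (∫ ω, g t (U ω) * Real.exp (-(Λ t (U ω))) ∂P) / (∫ ω, Real.exp (-(Λ t (U ω))) ∂P) := by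
  have hgs : ∀ s, Measurable (g s) := fun s => hg.comp (measurable_const.prodMk measurable_id)
  have hgu : ∀ u, Measurable (fun r => g r u) := fun u => hg.comp (measurable_id.prodMk measurable_const)
  have hΛm : ∀ s, 0 ≤ s → Measurable (Λ s) := by
    intro s hs
    have : Λ s = fun u => ∫ r in Ioc 0 s, g r u := by
      ext u; rw [hΛ, intervalIntegral.integral_of_le hs]
    rw [this]
    exact (hg.stronglyMeasurable.integral_prod_left' (μ := volume.restrict (Ioc 0 s))).measurable
  have hΛnn : ∀ s, 0 ≤ s → ∀ u, 0 ≤ Λ s u := by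
    intro s hs u
    rw [hΛ]; exact intervalIntegral.integral_nonneg hs (fun r _ => hgnn r u)
  have hexpm : ∀ s, 0 ≤ s → Measurable (fun u => Real.exp (-(Λ s u))) := fun s hs =>
    (hΛm s hs).neg.exp
  have hexpi : ∀ s, 0 ≤ s → Integrable (fun ω => Real.exp (-(Λ s (U ω)))) P := by
    intro s hs
    refine Integrable.of_bound ((hexpm s hs).comp hU).aestronglyMeasurable 1 (ae_of_all _ fun ω => ?_)
    rw [Real.norm_eq_abs, abs_of_pos (Real.exp_pos _)]
    exact Real.exp_le_one_iff.2 (by linarith [hΛnn s hs (U ω)])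
  have hTs : ∀ s, MeasurableSet {ω | s ≤ T ω} := fun s => measurableSet_le measurable_const hT
  -- survival
  have hS : ∀ s, 0 ≤ s → (P {ω | s ≤ T ω}).toReal = ∫ ω, Real.exp (-(Λ s (U ω))) ∂P := by
    intro s hs
    have := hsurv s hs univ MeasurableSet.univ
    simpa using this
  -- the bad set is null
  have hgood : ∀ᵐ ω ∂P, IntervalIntegrable (fun r => g r (U ω)) volume 0 t := by
    set B : Set E := {u | ∫⁻ r in Ioc 0 t, ENNReal.ofReal (g r u) = ⊤} with hB
    have hBm : MeasurableSet B := by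
      have : Measurable (fun u => ∫⁻ r in Ioc 0 t, ENNReal.ofReal (g r u)) :=
        Measurable.lintegral_prod_left' (μ := volume.restrict (Ioc 0 t))
          (f := fun p : ℝ × E => ENNReal.ofReal (g p.1 p.2)) hg.ennreal_ofReal
      exact this (measurableSet_singleton ⊤)
    have hBi : ∀ u, IntervalIntegrable (fun r => g r u) volume 0 t ↔ u ∉ B := by
      intro u
      rw [intervalIntegrable_iff_integrableOn_Ioc_of_le ht.le, IntegrableOn, Integrable,
        and_iff_right (hgu u).aestronglyMeasurable,
        hasFiniteIntegral_iff_ofReal (ae_of_all _ fun r => hgnn r u), lt_top_iff_ne_top]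
      rfl
    have hΛB : ∀ s, t ≤ s → ∀ u ∈ B, Λ s u = 0 := by
      intro s hs u hu
      rw [hΛ]
      apply intervalIntegral.integral_undef
      intro hc
      exact (hBi u).1 (hc.mono_set (by
        rw [uIcc_of_le ht.le, uIcc_of_le (ht.le.trans hs)]; exact Icc_subset_Icc_right hs)) hu
    have hP : ∀ n : ℕ, P (U ⁻¹' B) ≤ P {ω | t + n ≤ T ω} := by
      intro n
      have hn : t ≤ t + n := by simp
      have h1 := hsurv (t + n) (ht.le.trans hn) B hBm
      have h2 : (∫ ω, B.indicator (fun _ => (1:ℝ)) (U ω) * Real.exp (-(Λ (t+n) (U ω))) ∂P)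
          = ∫ ω, (U ⁻¹' B).indicator (fun _ => (1:ℝ)) ω ∂P := by
        congr 1; ext ω
        by_cases hω : U ω ∈ B
        · simp [hω, hΛB _ hn _ hω]
        · simp [hω]
      rw [h2, integral_indicator_const _ (hU hBm)] at h1
      have h3 : P (U ⁻¹' B) = P {ω | t + n ≤ T ω ∧ U ω ∈ B} := by
        rw [← ENNReal.toReal_eq_toReal_iff' (measure_ne_top _ _) (measure_ne_top _ _), h1]
        simp [Measure.real]
      rw [h3]
      exact measure_mono fun ω h => h.1
    have hlim : Tendsto (fun n : ℕ => P {ω | t + n ≤ T ω}) atTop (𝓝 0) := by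
      have := tendsto_measure_iInter_atTop (μ := P) (s := fun n : ℕ => {ω | t + n ≤ T ω})
        (fun n => (hTs _).nullMeasurableSet)
        (fun m n hmn ω (h : t + n ≤ T ω) => by
          have : (m:ℝ) ≤ n := by exact_mod_cast hmn
          show t + m ≤ T ω
          linarith) ⟨0, measure_ne_top _ _⟩
      have he : (⋂ n : ℕ, {ω | t + n ≤ T ω}) = ∅ := by
        ext ω
        simp only [mem_iInter, mem_ofPred_eq, mem_empty_iff_false, iff_false, not_forall, not_le]
        obtain ⟨n, hn⟩ := exists_nat_gt (T ω - t)
        exact ⟨n, by linarith⟩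
      rw [he, measure_empty] at this
      exact this
    have h0 : P (U ⁻¹' B) = 0 := le_antisymm (ge_of_tendsto' hlim hP) (zero_le)
    have : ∀ᵐ ω ∂P, ω ∉ U ⁻¹' B := measure_eq_zero_iff_ae_notMem.1 h0
    filter_upwards [this] with ω hω
    exact (hBi _).2 hω
  -- change of measure
  have hmeas : (P.restrict {ω | t ≤ T ω}).map U
      = (P.withDensity (fun ω => ENNReal.ofReal (Real.exp (-(Λ t (U ω)))))).map U := by
    ext B hB
    rw [Measure.map_apply hU hB, Measure.map_apply hU hB, Measure.restrict_apply (hU hB),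
      withDensity_apply _ (hU hB), ← ofReal_integral_eq_lintegral_ofReal
        (hexpi t ht.le).integrableOn (ae_of_all _ fun ω => (Real.exp_pos _).le)]
    have h1 := hsurv t ht.le B hB
    have h2 : (∫ ω, B.indicator (fun _ => (1:ℝ)) (U ω) * Real.exp (-(Λ t (U ω))) ∂P)
        = ∫ ω in U ⁻¹' B, Real.exp (-(Λ t (U ω))) ∂P := by
      rw [← integral_indicator (hU hB)]
      congr 1; ext ω
      by_cases hω : U ω ∈ B <;> simp [hω]
    rw [← h2, ← h1, ENNReal.ofReal_toReal (measure_ne_top _ _)]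
    congr 1
    ext ω; simp [and_comm]
  have hdm : Measurable (fun ω => ENNReal.ofReal (Real.exp (-(Λ t (U ω))))) :=
    ((hexpm t ht.le).comp hU).ennreal_ofReal
  have hdm' : Measurable (fun ω => Real.toNNReal (Real.exp (-(Λ t (U ω))))) :=
    ((hexpm t ht.le).comp hU).real_toNNReal
  have hI : (∫ ω in {ω | t ≤ T ω}, g t (U ω) ∂P)
      = ∫ ω, g t (U ω) * Real.exp (-(Λ t (U ω))) ∂P := by
    rw [← integral_map hU.aemeasurable (f := g t) (hgs t).aestronglyMeasurable, hmeas,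
      integral_map hU.aemeasurable (hgs t).aestronglyMeasurable]
    have := integral_withDensity_eq_integral_smul (μ := P) hdm' (fun ω => g t (U ω))
    refine this.trans ?_
    congr 1; ext ω
    rw [NNReal.smul_def, Real.coe_toNNReal _ (Real.exp_pos _).le, smul_eq_mul, mul_comm]
  -- domination
  have hdom : Integrable (fun ω => g (t + k/2) (U ω) * Real.exp (-(Λ t (U ω)))) P := by
    refine ⟨(((hgs _).comp hU).mul ((hexpm t ht.le).comp hU)).aestronglyMeasurable, ?_⟩
    rw [hasFiniteIntegral_iff_ofReal
      (ae_of_all _ fun ω => mul_nonneg (hgnn _ _) (Real.exp_pos _).le)]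
    have h1 := hint (k/2) ⟨by linarith, by linarith⟩
    rw [← lintegral_map (f := fun u => ENNReal.ofReal (g (t + k/2) u)) (hgs _).ennreal_ofReal hU, hmeas,
      lintegral_map (hgs _).ennreal_ofReal hU,
      lintegral_withDensity_eq_lintegral_mul _ hdm
        (g := fun ω => ENNReal.ofReal (g (t + k/2) (U ω))) ((hgs _).comp hU).ennreal_ofReal] at h1
    convert h1 using 3 with ω
    simp only [Pi.mul_apply]
    rw [mul_comm, ENNReal.ofReal_mul (Real.exp_pos _).le]
  have hii : ∀ u, ∀ h, 0 ≤ h → h ≤ k → IntervalIntegrable (fun r => g r u) volume t (t + h) := by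
    intro u h h0 h1
    apply ContinuousOn.intervalIntegrable
    rw [uIcc_of_le (by linarith)]
    exact (hcont u).mono (Icc_subset_Icc_right (by linarith))
  have hev : ∀ᶠ h : ℝ in 𝓝[>] 0, 0 < h ∧ h ≤ k/2 := by
    have : Ioc 0 (k/2) ∈ 𝓝[>] (0:ℝ) := Ioc_mem_nhdsGT (by linarith)
    exact this
  -- difference quotient
  have hDQ : Tendsto (fun h : ℝ => ∫ ω, h⁻¹ * (Real.exp (-(Λ t (U ω)))
        * (1 - Real.exp (-(∫ r in t..(t+h), g r (U ω))))) ∂P) (𝓝[>] 0)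
      (𝓝 (∫ ω, g t (U ω) * Real.exp (-(Λ t (U ω))) ∂P)) := by
    apply tendsto_integral_filter_of_dominated_convergence _ _ _ hdom
    · refine ae_of_all _ fun ω => ?_
      set u := U ω
      have hd : HasDerivWithinAt (fun x => ∫ r in t..x, g r u) (g t u) (Ici t) t := by
        refine intervalIntegral.integral_hasDerivWithinAt_right (by simp) (t := Ioi t)
          ((hgu u).stronglyMeasurable.stronglyMeasurableAtFilter) ?_
        exact ((hcont u).continuousWithinAt (left_mem_Icc.2 (by linarith))).mono_of_mem_nhdsWithin
            (mem_of_superset (Ioc_mem_nhdsGT (by linarith)) Ioc_subset_Icc_self)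
      have hd2 : HasDerivWithinAt (fun x => 1 - Real.exp (-(∫ r in t..x, g r u))) (g t u) (Ici t) t := by
        have := (hd.neg.exp).const_sub 1
        simpa using this
      have h3 := (hasDerivWithinAt_iff_tendsto_slope' (by simp)).1 hd2.Ioi_of_Ici
      have h4 : Tendsto (fun h : ℝ => t + h) (𝓝[>] 0) (𝓝[>] t) := by
        apply tendsto_nhdsWithin_of_tendsto_nhds_of_eventually_within
        · have : Tendsto (fun h : ℝ => t + h) (𝓝 0) (𝓝 (t + 0)) :=
            tendsto_const_nhds.add tendsto_id
          rw [add_zero] at this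
          exact this.mono_left nhdsWithin_le_nhds
        · filter_upwards [hev] with h hh
          show t < t + h
          linarith [hh.1]
      have h5 := (h3.comp h4).mul_const (Real.exp (-(Λ t u)))
      refine h5.congr fun h => ?_
      simp [slope_def_field]
      ring
    · filter_upwards [hev] with h hh
      have hm : Measurable (fun u => ∫ r in t..(t+h), g r u) := by
        have : (fun u => ∫ r in t..(t+h), g r u) = fun u => ∫ r in Ioc t (t+h), g r u := by
          ext u; rw [intervalIntegral.integral_of_le (by linarith)]
        rw [this]
        exact (hg.stronglyMeasurable.integral_prod_left'
          (μ := volume.restrict (Ioc t (t+h)))).measurable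
      have hm2 : Measurable (fun u => h⁻¹ * (Real.exp (-(Λ t u))
          * (1 - Real.exp (-(∫ r in t..(t+h), g r u))))) :=
        ((hexpm t ht.le).mul (measurable_const.sub hm.neg.exp)).const_mul _
      exact (hm2.comp hU).aestronglyMeasurable
    · filter_upwards [hev] with h hh
      refine ae_of_all _ fun ω => ?_
      set u := U ω
      have hJ0 : 0 ≤ ∫ r in t..(t+h), g r u :=
        intervalIntegral.integral_nonneg (by linarith) (fun r _ => hgnn r u)
      have hJ1 : (∫ r in t..(t+h), g r u) ≤ h * g (t + k/2) u := by
        have := intervalIntegral.integral_mono_on (a := t) (b := t + h) (μ := volume)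
          (f := fun r => g r u) (g := fun _ => g (t + k/2) u) (by linarith)
          (hii u h hh.1.le (by linarith)) (by simp) (fun r hr => hmono u
            ⟨hr.1, by linarith [hr.2]⟩ ⟨by linarith, by linarith⟩ (by linarith [hr.2]))
        simpa using this
      have he1 : Real.exp (-(∫ r in t..(t+h), g r u)) ≤ 1 := Real.exp_le_one_iff.2 (by linarith)
      have he2 := Real.add_one_le_exp (-(∫ r in t..(t+h), g r u))
      have hE := Real.exp_pos (-(Λ t u))
      have hi := inv_pos.2 hh.1
      rw [Real.norm_eq_abs, abs_of_nonneg
        (mul_nonneg hi.le (mul_nonneg hE.le (by linarith)))]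
      calc h⁻¹ * (Real.exp (-(Λ t u)) * (1 - Real.exp (-(∫ r in t..(t+h), g r u))))
          ≤ h⁻¹ * (Real.exp (-(Λ t u)) * (h * g (t + k/2) u)) := by
            gcongr; linarith
        _ = _ := by
            have := hh.1.ne'
            field_simp
  refine ⟨(∫ ω, g t (U ω) * Real.exp (-(Λ t (U ω))) ∂P) / (P {ω | t ≤ T ω}).toReal,
    ?_, by rw [hI], by rw [hS t ht.le]⟩
  refine (hDQ.div_const _).congr' ?_
  filter_upwards [hev] with h hh
  have hset : {ω | t ≤ T ω} ∩ {ω | T ω ∈ Ico t (t + h)} = {ω | t ≤ T ω} \ {ω | t + h ≤ T ω} := by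
    ext ω; simp
  have hsub : {ω | t + h ≤ T ω} ⊆ {ω | t ≤ T ω} := by
    intro ω (h1 : t + h ≤ T ω)
    show t ≤ T ω
    linarith [hh.1]
  rw [ProbabilityTheory.cond_apply (hTs t), hset,
    measure_sdiff hsub
      (hTs _).nullMeasurableSet (measure_ne_top _ _), ENNReal.toReal_mul, ENNReal.toReal_inv,
    ENNReal.toReal_sub_of_le (measure_mono
      hsub) (measure_ne_top _ _),
    integral_const_mul]
  have hkey : (∫ ω, Real.exp (-(Λ t (U ω))) * (1 - Real.exp (-(∫ r in t..(t+h), g r (U ω)))) ∂P)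
      = (P {ω | t ≤ T ω}).toReal - (P {ω | t + h ≤ T ω}).toReal := by
    rw [hS t ht.le, hS (t+h) (by linarith), ← integral_sub (hexpi t ht.le) (hexpi _ (by linarith))]
    apply integral_congr_ae
    filter_upwards [hgood] with ω hω
    have : Λ (t+h) (U ω) = Λ t (U ω) + ∫ r in t..(t+h), g r (U ω) := by
      rw [hΛ, hΛ, intervalIntegral.integral_add_adjacent_intervals hω
        (hii _ h hh.1.le (by linarith))]
    rw [this, neg_add, Real.exp_add]
    ring
  rw [hkey]
  ring

/-- Theorem 2 of the paper: the marginal hazards of the potential outcomes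
`T^a` and `T^0` at `t` exist, and their ratio (the marginal causal hazard ratio) equals
`E[f0(t,U0)f1(t,U1) | T^a ≥ t] / E[f0(t,U0) | T^0 ≥ t]`, which in turn equals the ratio of
reweighted population means. -/
theorem mchr_eq_ratio_of_selected_expectations
    {Ω : Type*} [MeasurableSpace Ω] (P : Measure Ω) [IsProbabilityMeasure P]
    (U0 U1 : Ω → ℝ) (hU0 : Measurable U0) (hU1 : Measurable U1)
    (Ta T0 : Ω → ℝ) (hTa : Measurable Ta) (hT0 : Measurable T0)
    (hTann : ∀ ω, 0 ≤ Ta ω) (hT0nn : ∀ ω, 0 ≤ T0 ω)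
    (f0 f1 : ℝ → ℝ → ℝ)
    (hf0 : Measurable (Function.uncurry f0)) (hf1 : Measurable (Function.uncurry f1))
    (hf0nn : ∀ s u, 0 ≤ f0 s u) (hf1nn : ∀ s u, 0 ≤ f1 s u)
    (Λa : ℝ → ℝ → ℝ → ℝ) (hΛa : ∀ s u0 u1, Λa s u0 u1 = ∫ r in (0:ℝ)..s, f0 r u0 * f1 r u1)
    (Λ0 : ℝ → ℝ → ℝ) (hΛ0 : ∀ s u0, Λ0 s u0 = ∫ r in (0:ℝ)..s, f0 r u0)
    (hsurva : ∀ s : ℝ, 0 ≤ s → ∀ B : Set (ℝ × ℝ), MeasurableSet B →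
      (P {ω | s ≤ Ta ω ∧ (U0 ω, U1 ω) ∈ B}).toReal
        = ∫ ω, B.indicator (fun _ => (1:ℝ)) (U0 ω, U1 ω)
            * Real.exp (-(Λa s (U0 ω) (U1 ω))) ∂P)
    (hsurv0 : ∀ s : ℝ, 0 ≤ s → ∀ B : Set ℝ, MeasurableSet B →
      (P {ω | s ≤ T0 ω ∧ U0 ω ∈ B}).toReal
        = ∫ ω, B.indicator (fun _ => (1:ℝ)) (U0 ω) * Real.exp (-(Λ0 s (U0 ω))) ∂P)
    (t : ℝ) (ht : 0 < t) (htilde : ℝ) (hhtilde : 0 < htilde)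
    (hmonoa : ∀ u0 u1, MonotoneOn (fun s => f0 s u0 * f1 s u1) (Icc t (t + htilde)))
    (hconta : ∀ u0 u1, ContinuousOn (fun s => f0 s u0 * f1 s u1) (Icc t (t + htilde)))
    (hmono0 : ∀ u0, MonotoneOn (fun s => f0 s u0) (Icc t (t + htilde)))
    (hcont0 : ∀ u0, ContinuousOn (fun s => f0 s u0) (Icc t (t + htilde)))
    (hinta : ∀ h : ℝ, h ∈ Ioo 0 htilde →
      ∫⁻ ω in {ω | t ≤ Ta ω}, ENNReal.ofReal (f0 (t + h) (U0 ω) * f1 (t + h) (U1 ω)) ∂P < ⊤)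
    (hint0 : ∀ h : ℝ, h ∈ Ioo 0 htilde →
      ∫⁻ ω in {ω | t ≤ T0 ω}, ENNReal.ofReal (f0 (t + h) (U0 ω)) ∂P < ⊤)
    (hposa : 0 < P {ω | t ≤ Ta ω}) (hpos0 : 0 < P {ω | t ≤ T0 ω})
    (hden : 0 < ∫ ω, f0 t (U0 ω) * Real.exp (-(Λ0 t (U0 ω))) ∂P) :
    ∃ lamA lam0 : ℝ,
      Tendsto
        (fun h : ℝ => h⁻¹ * ((ProbabilityTheory.cond P {ω | t ≤ Ta ω})
            {ω | Ta ω ∈ Ico t (t + h)}).toReal)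
        (𝓝[>] 0) (𝓝 lamA) ∧
      Tendsto
        (fun h : ℝ => h⁻¹ * ((ProbabilityTheory.cond P {ω | t ≤ T0 ω})
            {ω | T0 ω ∈ Ico t (t + h)}).toReal)
        (𝓝[>] 0) (𝓝 lam0) ∧
      lamA / lam0
        = ((∫ ω in {ω | t ≤ Ta ω}, f0 t (U0 ω) * f1 t (U1 ω) ∂P) / (P {ω | t ≤ Ta ω}).toReal)
          / ((∫ ω in {ω | t ≤ T0 ω}, f0 t (U0 ω) ∂P) / (P {ω | t ≤ T0 ω}).toReal) ∧
      lamA / lam0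
        = ((∫ ω, f0 t (U0 ω) * f1 t (U1 ω) * Real.exp (-(Λa t (U0 ω) (U1 ω))) ∂P)
              / (∫ ω, Real.exp (-(Λa t (U0 ω) (U1 ω))) ∂P))
          / ((∫ ω, f0 t (U0 ω) * Real.exp (-(Λ0 t (U0 ω))) ∂P)
              / (∫ ω, Real.exp (-(Λ0 t (U0 ω))) ∂P)) := by
  obtain ⟨LA, hA1, hA2, hA3⟩ := hazard_aux P (fun ω => (U0 ω, U1 ω)) (hU0.prodMk hU1) Ta hTa
    (fun s u => f0 s u.1 * f1 s u.2)
    ((hf0.comp (measurable_fst.prodMk (measurable_fst.comp measurable_snd))).mul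
      (hf1.comp (measurable_fst.prodMk (measurable_snd.comp measurable_snd))))
    (fun s u => mul_nonneg (hf0nn _ _) (hf1nn _ _))
    (fun s u => Λa s u.1 u.2) (fun s u => hΛa s u.1 u.2) hsurva t ht htilde hhtilde
    (fun u => hmonoa u.1 u.2) (fun u => hconta u.1 u.2) hinta
  obtain ⟨L0, h01, h02, h03⟩ := hazard_aux P U0 hU0 T0 hT0 f0 hf0 hf0nn Λ0 hΛ0 hsurv0 t ht
    htilde hhtilde hmono0 hcont0 hint0
  refine ⟨LA, L0, hA1, h01, ?_, ?_⟩
  · rw [← hA2, ← h02]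
  · rw [← hA3, ← h03]
end

section
/- Fix t > 0. Let U1 be a real random variable, let λ0 : [0,∞) → [0,∞) and f1 : [0,∞)×ℝ → [0,∞) be measurable (no frailty: the baseline hazard λ0 is the same for all individuals), set Λ^a(s,u1) = ∫_0^s λ0(r)f1(r,u1) dr and Λ^0(s) = ∫_0^s λ0(r) dr, and let T^a be a nonnegative random variable whose conditional survival given U1 is exp(−Λ^a(s,U1)), and T^0 a nonnegative random variable with P(T^0 ≥ s) = exp(−Λ^0(s)). Assume that for each u1 the maps s ↦ λ0(s)f1(s,u1) and s ↦ λ0(s) are nondecreasing and continuous on [t, t+h̃], that E[λ0(t+h)f1(t+h,U1)·1{T^a ≥ t}] < ∞ for all h ∈ (0,h̃), and that P(T^a ≥ t) > 0 and λ0(t) > 0. Then the marginal hazards at t exist and λ_{T^a}(t)/λ_{T^0}(t) = E[f1(t,U1) | T^a ≥ t] = E[f1(t,U1)·exp(−Λ^a(t,U1))] / E[exp(−Λ^a(t,U1))] (Corollary 4.2.1). -/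
open MeasureTheory Real Set Filter Topology

lemma aux_meas (g : ℝ → ℝ → ℝ) (hg : Measurable (Function.uncurry g))
    (Λ : ℝ → ℝ → ℝ) (hΛ : ∀ s u, Λ s u = ∫ r in (0:ℝ)..s, g r u) (s : ℝ) (hs : 0 ≤ s) :
    Measurable (Λ s) := by
  have : Λ s = fun u => ∫ r in Ioc 0 s, g r u := by
    funext u
    rw [hΛ, intervalIntegral.integral_of_le hs]
  rw [this]
  have h2 : StronglyMeasurable (Function.uncurry (fun u r => g r u)) :=
    (hg.comp measurable_swap).stronglyMeasurable
  exact (h2.integral_prod_right (ν := volume.restrict (Ioc 0 s))).measurable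

lemma aux_map {Ω : Type*} [MeasurableSpace Ω] (P : Measure Ω) [IsProbabilityMeasure P]
    (U : Ω → ℝ) (hU : Measurable U) (T : Ω → ℝ) (hT : Measurable T) (t : ℝ)
    (L : ℝ → ℝ) (hL : Measurable L) (hL0 : ∀ u, 0 ≤ L u)
    (hsurv : ∀ B : Set ℝ, MeasurableSet B →
      (P {ω | t ≤ T ω ∧ U ω ∈ B}).toReal
        = ∫ ω, B.indicator (fun _ => (1:ℝ)) (U ω) * Real.exp (-(L (U ω))) ∂P) :
    (P.restrict {ω | t ≤ T ω}).map U
      = (P.map U).withDensity (fun u => ENNReal.ofReal (Real.exp (-(L u)))) := by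
  ext B hB
  have hA : MeasurableSet {ω | t ≤ T ω} := measurableSet_le measurable_const hT
  rw [Measure.map_apply hU hB, Measure.restrict_apply (hU hB), withDensity_apply _ hB,
    setLIntegral_map hB (by fun_prop) hU]
  have h1 : U ⁻¹' B ∩ {ω | t ≤ T ω} = {ω | t ≤ T ω ∧ U ω ∈ B} := by
    ext ω; simp [and_comm]
  rw [h1, ← ENNReal.ofReal_toReal (measure_ne_top P {ω | t ≤ T ω ∧ U ω ∈ B}), hsurv B hB]
  have h2 : (fun ω => B.indicator (fun _ => (1:ℝ)) (U ω) * Real.exp (-(L (U ω))))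
      = (U ⁻¹' B).indicator (fun ω => Real.exp (-(L (U ω)))) := by
    funext ω
    by_cases h : U ω ∈ B <;> simp [h]
  rw [h2, integral_indicator (hU hB), ofReal_integral_eq_lintegral_ofReal]
  · refine Integrable.mono' (g := fun _ => (1:ℝ)) (integrable_const _)
      (Real.measurable_exp.comp ((hL.comp hU).neg)).aestronglyMeasurable ?_
    refine ae_of_all _ fun ω => ?_
    rw [Real.norm_eq_abs, abs_of_pos (Real.exp_pos _)]
    exact Real.exp_le_one_iff.mpr (by linarith [hL0 (U ω)])
  · exact ae_of_all _ fun ω => (Real.exp_pos _).le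

lemma aux_null {Ω : Type*} [MeasurableSpace Ω] (P : Measure Ω) [IsProbabilityMeasure P]
    (U : Ω → ℝ) (hU : Measurable U) (T : Ω → ℝ) (hT : Measurable T)
    (g : ℝ → ℝ → ℝ) (hg : Measurable (Function.uncurry g))
    (hg0 : ∀ s u, 0 ≤ g s u)
    (Λ : ℝ → ℝ → ℝ) (hΛ : ∀ s u, Λ s u = ∫ r in (0:ℝ)..s, g r u)
    (hsurv : ∀ s : ℝ, 0 ≤ s → ∀ B : Set ℝ, MeasurableSet B →
      (P {ω | s ≤ T ω ∧ U ω ∈ B}).toReal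
        = ∫ ω, B.indicator (fun _ => (1:ℝ)) (U ω) * Real.exp (-(Λ s (U ω))) ∂P)
    (t : ℝ) (ht : 0 < t) :
    ∀ᵐ ω ∂P, IntervalIntegrable (fun r => g r (U ω)) volume 0 t := by
  set N : Set ℝ := {u | ∫⁻ r in Ioc 0 t, ENNReal.ofReal (g r u) = ⊤} with hN
  have hgm : ∀ u, Measurable (fun r => g r u) := fun u => hg.comp (by fun_prop : Measurable fun r => (r, u))
  have hNm : MeasurableSet N := by
    have h2 : Measurable (Function.uncurry (fun u r => ENNReal.ofReal (g r u))) :=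
      ENNReal.measurable_ofReal.comp (hg.comp measurable_swap)
    exact (h2.lintegral_prod_right' (ν := volume.restrict (Ioc 0 t))) (measurableSet_singleton ⊤)
  have hii : ∀ u, u ∉ N ↔ IntervalIntegrable (fun r => g r u) volume 0 t := by
    intro u
    rw [intervalIntegrable_iff_integrableOn_Ioc_of_le ht.le, IntegrableOn,
      ← lintegral_ofReal_ne_top_iff_integrable (hgm u).aestronglyMeasurable
        (ae_of_all _ fun r => hg0 r u)]
    rfl
  have hz : ∀ s, t ≤ s → ∀ u ∈ N, Λ s u = 0 := by
    intro s hs u hu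
    rw [hΛ]
    apply intervalIntegral.integral_undef
    intro h
    refine (hii u).2 (h.mono_set ?_) hu
    rw [uIcc_of_le ht.le, uIcc_of_le (ht.le.trans hs)]
    exact Icc_subset_Icc_right hs
  have hc : ∀ n : ℕ, t ≤ n → (P {ω | (n:ℝ) ≤ T ω ∧ U ω ∈ N}).toReal = (P (U ⁻¹' N)).toReal := by
    intro n hn
    rw [hsurv n (ht.le.trans hn) N hNm]
    have : (fun ω => N.indicator (fun _ => (1:ℝ)) (U ω) * Real.exp (-(Λ n (U ω))))
        = (U ⁻¹' N).indicator (fun _ => (1:ℝ)) := by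
      funext ω
      by_cases h : U ω ∈ N
      · simp [h, hz n hn _ h]
      · simp [h]
    rw [this, integral_indicator (hU hNm)]
    simp [Measure.real]
  have hlim : Tendsto (fun n : ℕ => P {ω | (n:ℝ) ≤ T ω ∧ U ω ∈ N}) atTop (𝓝 0) := by
    have h := tendsto_measure_iInter_atTop (μ := P) (s := fun n : ℕ => {ω | (n:ℝ) ≤ T ω ∧ U ω ∈ N})
      (fun n => ((measurableSet_le measurable_const hT).inter (hU hNm)).nullMeasurableSet)
      (fun m n hmn ω hω => ⟨(Nat.cast_le.mpr hmn).trans hω.1, hω.2⟩) ⟨0, measure_ne_top _ _⟩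
    have he : (⋂ n : ℕ, {ω | (n:ℝ) ≤ T ω ∧ U ω ∈ N}) = ∅ := by
      ext ω
      simp only [mem_iInter, mem_ofPred_eq, mem_empty_iff_false, iff_false, not_forall]
      obtain ⟨n, hn⟩ := exists_nat_gt (T ω)
      exact ⟨n, fun h => absurd h.1 (not_le.mpr hn)⟩
    rw [he, measure_empty] at h
    exact h
  have hconst : (fun n : ℕ => P {ω | (n:ℝ) ≤ T ω ∧ U ω ∈ N}) =ᶠ[atTop] fun _ => P (U ⁻¹' N) := by
    obtain ⟨m, hm⟩ := exists_nat_ge t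
    filter_upwards [eventually_ge_atTop m] with n hn
    exact (ENNReal.toReal_eq_toReal_iff' (measure_ne_top _ _) (measure_ne_top _ _)).1
      (hc n (hm.trans (Nat.cast_le.mpr hn)))
  have h0 : P (U ⁻¹' N) = 0 :=
    tendsto_nhds_unique (tendsto_const_nhds.congr' hconst.symm) hlim
  have : ∀ᵐ ω ∂P, U ω ∉ N := by
    rw [ae_iff]; simp only [not_not]; exact h0
  filter_upwards [this] with ω hω using (hii _).1 hω

lemma aux_pt (k : ℝ → ℝ) (t d : ℝ) (hd : 0 < d) (hm : Measurable k)
    (hcont : ContinuousOn k (Icc t (t + d))) :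
    Tendsto (fun h : ℝ => h⁻¹ * (∫ r in t..(t + h), k r)) (𝓝[>] 0) (𝓝 (k t)) := by
  have hmem : Icc t (t + d) ∈ 𝓝[>] t :=
    mem_of_superset (Ioo_mem_nhdsGT (by linarith : t < t + d)) Ioo_subset_Icc_self
  have hc : ContinuousWithinAt k (Ioi t) t :=
    (hcont t ⟨le_rfl, by linarith⟩).mono_of_mem_nhdsWithin hmem
  have hder : HasDerivWithinAt (fun s => ∫ r in t..s, k r) (k t) (Ioi t) t := by
    have := intervalIntegral.integral_hasDerivWithinAt_right (f := k) (a := t) (b := t)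
      (s := Ici t) (t := Ioi t) (by simp)
      (hm.stronglyMeasurable.stronglyMeasurableAtFilter) hc
    exact this.mono Ioi_subset_Ici_self
  rw [hasDerivWithinAt_iff_tendsto_slope' (by simp)] at hder
  have ht2 : Tendsto (fun h : ℝ => t + h) (𝓝[>] 0) (𝓝[>] t) := by
    apply tendsto_nhdsWithin_of_tendsto_nhds_of_eventually_within
    · have : Tendsto (fun h : ℝ => t + h) (𝓝 0) (𝓝 (t + 0)) := by
        exact (continuous_const.add continuous_id).tendsto 0
      rw [add_zero] at this
      exact this.mono_left nhdsWithin_le_nhds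
    · filter_upwards [self_mem_nhdsWithin] with h hh
      simpa using hh
  refine (hder.comp ht2).congr fun h => ?_
  simp [slope_def_field]
  ring

lemma aux_exp (F : ℝ → ℝ) (a : ℝ)
    (hF : Tendsto (fun h : ℝ => h⁻¹ * F h) (𝓝[>] 0) (𝓝 a)) :
    Tendsto (fun h : ℝ => h⁻¹ * (1 - Real.exp (-(F h)))) (𝓝[>] 0) (𝓝 a) := by
  have hid : Tendsto (fun h : ℝ => h) (𝓝[>] 0) (𝓝 0) := nhdsWithin_le_nhds
  have hF0 : Tendsto F (𝓝[>] 0) (𝓝 0) := by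
    have := hid.mul hF
    rw [zero_mul] at this
    refine this.congr' ?_
    filter_upwards [self_mem_nhdsWithin] with h hh
    have : h ≠ 0 := ne_of_gt hh
    field_simp
  have hd : HasDerivAt (fun x : ℝ => 1 - Real.exp (-x)) 1 0 := by
    have := ((hasDerivAt_neg (0:ℝ)).exp).const_sub 1
    simpa using this
  have hc := hd.continuousAt_div
  have h1 : Tendsto (Function.update (fun x => ((1 - Real.exp (-x)) - (1 - Real.exp (-0)))/(x-0)) 0 (1:ℝ))
      (𝓝 0) (𝓝 1) := by
    have := hc.tendsto
    simpa using this
  have h2 := hF.mul (h1.comp hF0)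
  rw [mul_one] at h2
  refine h2.congr fun h => ?_
  by_cases hz : F h = 0
  · simp [hz]
  · simp [Function.update_of_ne hz]
    field_simp

lemma aux_key {Ω : Type*} [MeasurableSpace Ω] (P : Measure Ω) [IsProbabilityMeasure P]
    (U : Ω → ℝ) (hU : Measurable U) (T : Ω → ℝ) (hT : Measurable T)
    (g : ℝ → ℝ → ℝ) (hg : Measurable (Function.uncurry g))
    (hg0 : ∀ s u, 0 ≤ g s u)
    (Λ : ℝ → ℝ → ℝ) (hΛ : ∀ s u, Λ s u = ∫ r in (0:ℝ)..s, g r u)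
    (hsurv : ∀ s : ℝ, 0 ≤ s → ∀ B : Set ℝ, MeasurableSet B →
      (P {ω | s ≤ T ω ∧ U ω ∈ B}).toReal
        = ∫ ω, B.indicator (fun _ => (1:ℝ)) (U ω) * Real.exp (-(Λ s (U ω))) ∂P)
    (t : ℝ) (ht : 0 < t) (d : ℝ) (hd : 0 < d)
    (hmono : ∀ u, MonotoneOn (fun s => g s u) (Icc t (t + d)))
    (hcont : ∀ u, ContinuousOn (fun s => g s u) (Icc t (t + d)))
    (hint : ∀ h : ℝ, h ∈ Ioo 0 d →
      ∫⁻ ω in {ω | t ≤ T ω}, ENNReal.ofReal (g (t + h) (U ω)) ∂P < ⊤) :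
    Tendsto
        (fun h : ℝ => h⁻¹ * ((ProbabilityTheory.cond P {ω | t ≤ T ω})
            {ω | T ω ∈ Ico t (t + h)}).toReal)
        (𝓝[>] 0) (𝓝 ((P {ω | t ≤ T ω}).toReal⁻¹ *
          ∫ ω, g t (U ω) * Real.exp (-(Λ t (U ω))) ∂P)) := by
  have hA : ∀ s, MeasurableSet {ω | s ≤ T ω} := fun s => measurableSet_le measurable_const hT
  have hgm : ∀ u, Measurable (fun r => g r u) := fun u => hg.comp (by fun_prop : Measurable fun r => (r, u))
  have hgm' : ∀ s, Measurable (g s) := fun s => hg.comp (by fun_prop : Measurable fun u => (s, u))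
  have hΛm : ∀ s, 0 ≤ s → Measurable (Λ s) := fun s hs => aux_meas g hg Λ hΛ s hs
  have hΛ0 : ∀ s, 0 ≤ s → ∀ u, 0 ≤ Λ s u := by
    intro s hs u
    rw [hΛ]
    exact intervalIntegral.integral_nonneg hs fun r _ => hg0 r u
  have hem : ∀ s, 0 ≤ s → Measurable (fun ω => Real.exp (-(Λ s (U ω)))) := fun s hs =>
    Real.measurable_exp.comp (((hΛm s hs).comp hU).neg)
  have hei : ∀ s, 0 ≤ s → Integrable (fun ω => Real.exp (-(Λ s (U ω)))) P := by
    intro s hs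
    refine Integrable.mono' (g := fun _ => (1:ℝ)) (integrable_const _)
      (hem s hs).aestronglyMeasurable (ae_of_all _ fun ω => ?_)
    rw [Real.norm_eq_abs, abs_of_pos (Real.exp_pos _)]
    exact Real.exp_le_one_iff.mpr (by linarith [hΛ0 s hs (U ω)])
  have hsv : ∀ s, 0 ≤ s → (P {ω | s ≤ T ω}).toReal = ∫ ω, Real.exp (-(Λ s (U ω))) ∂P := by
    intro s hs
    have := hsurv s hs univ MeasurableSet.univ
    simpa using this
  have hnull := aux_null P U hU T hT g hg hg0 Λ hΛ hsurv t ht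
  have hci : ∀ u, ∀ h ∈ Icc 0 d, IntervalIntegrable (fun r => g r u) volume t (t + h) := by
    intro u h hh
    apply ContinuousOn.intervalIntegrable
    rw [uIcc_of_le (by linarith [hh.1])]
    exact (hcont u).mono (Icc_subset_Icc_right (by linarith [hh.2]))
  have hadd : ∀ᵐ ω ∂P, ∀ h ∈ Icc 0 d,
      Λ (t + h) (U ω) = Λ t (U ω) + ∫ r in t..(t + h), g r (U ω) := by
    filter_upwards [hnull] with ω hω h hh
    rw [hΛ, hΛ, intervalIntegral.integral_add_adjacent_intervals hω (hci _ h hh)]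
  have hbi : Integrable (fun ω => g (t + d/2) (U ω) * Real.exp (-(Λ t (U ω)))) P := by
    have m1 : Measurable (fun u => ENNReal.ofReal (Real.exp (-(Λ t u)))) :=
      ENNReal.measurable_ofReal.comp (Real.measurable_exp.comp (hΛm t ht.le).neg)
    have m2 : Measurable (fun u => ENNReal.ofReal (g (t + d/2) u)) :=
      ENNReal.measurable_ofReal.comp (hgm' _)
    have h1 := hint (d/2) ⟨by linarith, by linarith⟩
    rw [← lintegral_map (f := fun u => ENNReal.ofReal (g (t + d/2) u)) (g := U)
      (ENNReal.measurable_ofReal.comp (hgm' _)) hU,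
      aux_map P U hU T hT t (Λ t) (hΛm t ht.le) (hΛ0 t ht.le) (hsurv t ht.le),
      lintegral_withDensity_eq_lintegral_mul _ m1 m2, lintegral_map (m1.mul m2) hU] at h1
    refine (lintegral_ofReal_ne_top_iff_integrable
      (((hgm' _).comp hU).mul (hem t ht.le)).aestronglyMeasurable
      (ae_of_all _ fun ω => mul_nonneg (hg0 _ _) (Real.exp_pos _).le)).1 ?_
    refine ne_of_lt (lt_of_le_of_lt (le_of_eq ?_) h1)
    refine lintegral_congr fun ω => ?_
    show ENNReal.ofReal (g (t + d/2) (U ω) * Real.exp (-(Λ t (U ω)))) = _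
    rw [mul_comm, ENNReal.ofReal_mul (Real.exp_pos _).le]
    rfl
  have hD : Tendsto (fun h : ℝ => ∫ ω, h⁻¹ *
      (Real.exp (-(Λ t (U ω))) - Real.exp (-(Λ (t + h) (U ω)))) ∂P) (𝓝[>] 0)
      (𝓝 (∫ ω, g t (U ω) * Real.exp (-(Λ t (U ω))) ∂P)) := by
    apply tendsto_integral_filter_of_dominated_convergence
      (fun ω => g (t + d/2) (U ω) * Real.exp (-(Λ t (U ω))))
    · filter_upwards [self_mem_nhdsWithin] with h hh
      have hh' : (0:ℝ) < h := hh
      exact (((hem t ht.le).sub (hem (t+h) (by linarith))).const_mul _).aestronglyMeasurable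
    · filter_upwards [Ioo_mem_nhdsGT (by linarith : (0:ℝ) < d/2)] with h hh
      filter_upwards [hadd] with ω hω
      rw [hω h ⟨hh.1.le, by linarith [hh.2]⟩]
      set I := ∫ r in t..(t + h), g r (U ω) with hI
      have hI0 : 0 ≤ I := intervalIntegral.integral_nonneg (by linarith [hh.1]) fun r _ => hg0 r _
      have hI1 : I ≤ h * g (t + d/2) (U ω) := by
        have := intervalIntegral.integral_mono_on (μ := volume) (by linarith [hh.1] : t ≤ t + h)
          (hci (U ω) h ⟨hh.1.le, by linarith [hh.2]⟩)
          (intervalIntegrable_const (c := g (t + d/2) (U ω)))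
          (fun r hr => hmono (U ω) ⟨hr.1, by linarith [hr.2, hh.2]⟩
            ⟨by linarith, by linarith⟩ (by linarith [hr.2, hh.2]))
        simpa using this
      have hE : Real.exp (-(Λ t (U ω))) - Real.exp (-(Λ t (U ω) + I))
          = Real.exp (-(Λ t (U ω))) * (1 - Real.exp (-I)) := by
        rw [neg_add, Real.exp_add]; ring
      have h1 : 1 - Real.exp (-I) ≤ I := by linarith [Real.add_one_le_exp (-I)]
      have h2 : 0 ≤ 1 - Real.exp (-I) := by
        linarith [Real.exp_le_one_iff.mpr (by linarith : -I ≤ 0)]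
      have hep := Real.exp_pos (-(Λ t (U ω)))
      have hhi : 0 < h⁻¹ := inv_pos.mpr hh.1
      rw [hE, Real.norm_eq_abs, abs_of_nonneg (by positivity)]
      calc h⁻¹ * (Real.exp (-(Λ t (U ω))) * (1 - Real.exp (-I)))
          ≤ h⁻¹ * (Real.exp (-(Λ t (U ω))) * (h * g (t + d/2) (U ω))) := by
            gcongr
            linarith
        _ = _ := by
            have : h ≠ 0 := hh.1.ne'
            field_simp
    · exact hbi
    · filter_upwards [hadd] with ω hω
      have h1 := aux_exp _ _ (aux_pt (fun r => g r (U ω)) t d hd (hgm _) (hcont _))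
      have h2 := h1.mul_const (Real.exp (-(Λ t (U ω))))
      refine h2.congr' ?_
      filter_upwards [Ioo_mem_nhdsGT hd] with h hh
      rw [hω h ⟨hh.1.le, hh.2.le⟩, neg_add, Real.exp_add]
      ring
  refine (hD.const_mul _).congr' ?_
  filter_upwards [self_mem_nhdsWithin] with h hh
  have hh' : (0:ℝ) < h := hh
  rw [ProbabilityTheory.cond_apply (hA t), integral_const_mul, integral_sub (hei t ht.le)
    (hei (t+h) (by linarith)), ← hsv t ht.le, ← hsv (t+h) (by linarith)]
  have hs : {ω | t ≤ T ω} ∩ {ω | T ω ∈ Ico t (t + h)} = {ω | t ≤ T ω} \ {ω | t + h ≤ T ω} := by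
    ext ω
    simp only [mem_inter_iff, mem_ofPred_eq, mem_Ico, Set.mem_sdiff, not_le]
    tauto
  have hsub : {ω | t + h ≤ T ω} ⊆ {ω | t ≤ T ω} := fun ω hω => by
    have : t + h ≤ T ω := hω
    show t ≤ T ω
    linarith
  rw [hs, measure_sdiff hsub (hA _).nullMeasurableSet (measure_ne_top _ _), ENNReal.toReal_mul,
    ENNReal.toReal_sub_of_le (measure_mono hsub) (measure_ne_top _ _), ENNReal.toReal_inv]
  ring

/-- Corollary 4.2.1: with effect heterogeneity but no frailty, the marginal
causal hazard ratio equals the conditional expectation of the individual effect modifier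
among exposed survivors: `E[f1(t,U1) | T^a ≥ t]`. -/
theorem mchr_effect_heterogeneity_no_frailty
    {Ω : Type*} [MeasurableSpace Ω] (P : Measure Ω) [IsProbabilityMeasure P]
    (U1 : Ω → ℝ) (hU1 : Measurable U1)
    (Ta T0 : Ω → ℝ) (hTa : Measurable Ta) (hT0 : Measurable T0)
    (hTann : ∀ ω, 0 ≤ Ta ω) (hT0nn : ∀ ω, 0 ≤ T0 ω)
    (lam0 : ℝ → ℝ) (f1 : ℝ → ℝ → ℝ)
    (hlam0meas : Measurable lam0) (hf1 : Measurable (Function.uncurry f1))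
    (hlam0nn : ∀ s, 0 ≤ lam0 s) (hf1nn : ∀ s u, 0 ≤ f1 s u)
    (Λa : ℝ → ℝ → ℝ) (hΛa : ∀ s u1, Λa s u1 = ∫ r in (0:ℝ)..s, lam0 r * f1 r u1)
    (Λ0 : ℝ → ℝ) (hΛ0 : ∀ s, Λ0 s = ∫ r in (0:ℝ)..s, lam0 r)
    (hsurva : ∀ s : ℝ, 0 ≤ s → ∀ B : Set ℝ, MeasurableSet B →
      (P {ω | s ≤ Ta ω ∧ U1 ω ∈ B}).toReal
        = ∫ ω, B.indicator (fun _ => (1:ℝ)) (U1 ω) * Real.exp (-(Λa s (U1 ω))) ∂P)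
    (hsurv0 : ∀ s : ℝ, 0 ≤ s → (P {ω | s ≤ T0 ω}).toReal = Real.exp (-(Λ0 s)))
    (t : ℝ) (ht : 0 < t) (htilde : ℝ) (hhtilde : 0 < htilde)
    (hmonoa : ∀ u1, MonotoneOn (fun s => lam0 s * f1 s u1) (Icc t (t + htilde)))
    (hconta : ∀ u1, ContinuousOn (fun s => lam0 s * f1 s u1) (Icc t (t + htilde)))
    (hmono0 : MonotoneOn lam0 (Icc t (t + htilde)))
    (hcont0 : ContinuousOn lam0 (Icc t (t + htilde)))
    (hinta : ∀ h : ℝ, h ∈ Ioo 0 htilde →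
      ∫⁻ ω in {ω | t ≤ Ta ω}, ENNReal.ofReal (lam0 (t + h) * f1 (t + h) (U1 ω)) ∂P < ⊤)
    (hposa : 0 < P {ω | t ≤ Ta ω}) (hlam0pos : 0 < lam0 t) :
    ∃ lamA lamZ : ℝ,
      Tendsto
        (fun h : ℝ => h⁻¹ * ((ProbabilityTheory.cond P {ω | t ≤ Ta ω})
            {ω | Ta ω ∈ Ico t (t + h)}).toReal)
        (𝓝[>] 0) (𝓝 lamA) ∧
      Tendsto
        (fun h : ℝ => h⁻¹ * ((ProbabilityTheory.cond P {ω | t ≤ T0 ω})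
            {ω | T0 ω ∈ Ico t (t + h)}).toReal)
        (𝓝[>] 0) (𝓝 lamZ) ∧
      lamA / lamZ
        = (∫ ω in {ω | t ≤ Ta ω}, f1 t (U1 ω) ∂P) / (P {ω | t ≤ Ta ω}).toReal ∧
      lamA / lamZ
        = (∫ ω, f1 t (U1 ω) * Real.exp (-(Λa t (U1 ω))) ∂P)
            / (∫ ω, Real.exp (-(Λa t (U1 ω))) ∂P) := by
  have hgm : Measurable (Function.uncurry (fun s u => lam0 s * f1 s u)) :=
    (hlam0meas.comp measurable_fst).mul hf1
  have hg0 : ∀ s u, 0 ≤ lam0 s * f1 s u := fun s u => mul_nonneg (hlam0nn s) (hf1nn s u)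
  have kA := aux_key P U1 hU1 Ta hTa (fun s u => lam0 s * f1 s u) hgm hg0 Λa hΛa hsurva t ht
    htilde hhtilde hmonoa hconta hinta
  have kZ := aux_key P (fun _ => 0) measurable_const T0 hT0 (fun s _ => lam0 s)
    (hlam0meas.comp measurable_fst) (fun s _ => hlam0nn s) (fun s _ => Λ0 s) (fun s _ => hΛ0 s)
    (by
      intro s hs B hB
      by_cases h : (0:ℝ) ∈ B
      · simpa [h] using hsurv0 s hs
      · simp [h]) t ht htilde hhtilde (fun _ => hmono0) (fun _ => hcont0)
    (by
      intro h hh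
      rw [lintegral_const]
      exact ENNReal.mul_lt_top ENNReal.ofReal_lt_top (measure_lt_top _ _))
  have hZ : (P {ω | t ≤ T0 ω}).toReal⁻¹ * ∫ ω, lam0 t * Real.exp (-(Λ0 t)) ∂P = lam0 t := by
    rw [hsurv0 t ht.le]
    simp
    field_simp
  rw [hZ] at kZ
  have hΛm : Measurable (Λa t) := aux_meas _ hgm Λa hΛa t ht.le
  have hΛ0' : ∀ u, 0 ≤ Λa t u := by
    intro u
    rw [hΛa]
    exact intervalIntegral.integral_nonneg ht.le fun r _ => hg0 r u
  have hfm : Measurable (f1 t) := hf1.comp (by fun_prop : Measurable fun u => (t, u))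
  have hsv : (P {ω | t ≤ Ta ω}).toReal = ∫ ω, Real.exp (-(Λa t (U1 ω))) ∂P := by
    simpa using hsurva t ht.le univ MeasurableSet.univ
  have hden : Measurable (fun u => Real.exp (-(Λa t u))) := Real.measurable_exp.comp hΛm.neg
  have hden2 : Measurable (fun u => ENNReal.ofReal (Real.exp (-(Λa t u)))) :=
    ENNReal.measurable_ofReal.comp hden
  have hch : ∫ ω in {ω | t ≤ Ta ω}, f1 t (U1 ω) ∂P
      = ∫ ω, f1 t (U1 ω) * Real.exp (-(Λa t (U1 ω))) ∂P := by
    rw [← integral_map (f := f1 t) hU1.aemeasurable hfm.aestronglyMeasurable,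
      aux_map P U1 hU1 Ta hTa t (Λa t) hΛm hΛ0' (hsurva t ht.le),
      integral_withDensity_eq_integral_toReal_smul hden2
        (ae_of_all _ fun _ => ENNReal.ofReal_lt_top)]
    simp only [ENNReal.toReal_ofReal (Real.exp_pos _).le, smul_eq_mul]
    rw [integral_map (f := fun u => Real.exp (-(Λa t u)) * f1 t u) hU1.aemeasurable
      (hden.mul hfm).aestronglyMeasurable]
    simp only [mul_comm]
  have hfin : ((P {ω | t ≤ Ta ω}).toReal⁻¹ *
      ∫ ω, lam0 t * f1 t (U1 ω) * Real.exp (-(Λa t (U1 ω))) ∂P) / lam0 t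
      = (∫ ω, f1 t (U1 ω) * Real.exp (-(Λa t (U1 ω))) ∂P) / (P {ω | t ≤ Ta ω}).toReal := by
    simp only [mul_assoc]
    rw [integral_const_mul]
    field_simp
  refine ⟨_, _, kA, kZ, ?_, ?_⟩
  · rw [hfin, hch]
  · rw [hfin, hsv]
end

section
/- Let μ > 0 and λ > 0, and let f : ℝ → [0,∞) be the inverse Gaussian density f(x) = √(λ/(2π·x³))·exp(−λ·(x−μ)²/(2μ²·x)) for x > 0 and f(x) = 0 for x ≤ 0. Then for every c ≥ 0, ∫_ℝ exp(−c·x)·f(x) dx = exp((λ/μ)·(1 − √(1 + 2μ²·c/λ))). In particular (c = 0) f is a probability density, and the Laplace transform of the inverse Gaussian distribution IG(μ,λ) is 𝓛(c) = exp((λ/μ)(1 − √(1 + 2μ²c/λ))). -/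
open MeasureTheory Real Set Filter Topology

lemma ig_cosh (k : ℝ) (hk : 0 < k) :
    Integrable (fun t : ℝ => cosh t * exp (-(2 * k) * sinh t ^ 2)) ∧
    ∫ t : ℝ, cosh t * exp (-(2 * k) * sinh t ^ 2) = √(π / (2 * k)) := by
  have hd : ∀ x ∈ (univ : Set ℝ), HasDerivWithinAt sinh (cosh x) univ x :=
    fun x _ => (Real.hasDerivAt_sinh x).hasDerivWithinAt
  have hi : InjOn sinh (univ : Set ℝ) := Real.sinh_injective.injOn
  have him : sinh '' (univ : Set ℝ) = univ := by
    rw [image_univ]; exact Real.sinh_surjective.range_eq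
  have h1 := integrableOn_image_iff_integrableOn_abs_deriv_smul MeasurableSet.univ hd hi
    (fun y => exp (-(2 * k) * y ^ 2))
  have h2 := integral_image_eq_integral_abs_deriv_smul MeasurableSet.univ hd hi
    (fun y => exp (-(2 * k) * y ^ 2))
  rw [him] at h1 h2
  simp only [integrableOn_univ, abs_of_pos (Real.cosh_pos _), smul_eq_mul, Measure.restrict_univ] at h1 h2
  refine ⟨h1.1 (integrable_exp_neg_mul_sq (by positivity)), ?_⟩
  rw [← h2, integral_gaussian]

lemma ig_exp (k : ℝ) (hk : 0 < k) :
    ∫ t : ℝ, exp (-t) * exp (-(2 * k) * sinh t ^ 2) = √(π / (2 * k)) := by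
  obtain ⟨hI, hv⟩ := ig_cosh k hk
  have hint : Integrable (fun t : ℝ => exp (-t) * exp (-(2 * k) * sinh t ^ 2)) := by
    refine (hI.const_mul 2).mono' (by fun_prop) (ae_of_all _ fun t => ?_)
    rw [Real.norm_of_nonneg (by positivity), ← mul_assoc]
    refine mul_le_mul_of_nonneg_right ?_ (exp_pos _).le
    rw [Real.cosh_eq]; linarith [exp_pos t]
  have hint2 : Integrable (fun t : ℝ => exp t * exp (-(2 * k) * sinh t ^ 2)) := by
    simpa using hint.comp_neg
  have hs : ∫ t : ℝ, exp t * exp (-(2 * k) * sinh t ^ 2)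
      = ∫ t : ℝ, exp (-t) * exp (-(2 * k) * sinh t ^ 2) := by
    rw [← integral_neg_eq_self]; simp
  have ha := integral_add hint hint2
  have hb : ∫ t : ℝ, (exp (-t) * exp (-(2 * k) * sinh t ^ 2) + exp t * exp (-(2 * k) * sinh t ^ 2))
      = 2 * √(π / (2 * k)) := by
    rw [← hv, ← integral_const_mul]
    congr 1; ext t; rw [Real.cosh_eq]; ring
  rw [hb, hs] at ha
  linarith

lemma ig_one (m l : ℝ) (hm : 0 < m) (hl : 0 < l) :
    ∫ x in Ioi (0:ℝ), √(l / (2 * π * x ^ 3)) * exp (-(l * (x - m) ^ 2 / (2 * m ^ 2 * x))) = 1 := by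
  have hd : ∀ t ∈ (univ : Set ℝ),
      HasDerivWithinAt (fun t => m * exp (2 * t)) (m * (exp (2 * t) * 2)) univ t := by
    intro t _
    have := (((hasDerivAt_id t).const_mul 2).exp).const_mul m
    simpa using this
  have hi : InjOn (fun t => m * exp (2 * t)) (univ : Set ℝ) := by
    intro a _ b _ h
    have := exp_injective (mul_left_cancel₀ hm.ne' h)
    linarith
  have him : (fun t => m * exp (2 * t)) '' (univ : Set ℝ) = Ioi 0 := by
    ext x
    simp only [image_univ, mem_range, mem_Ioi]
    constructor
    · rintro ⟨t, rfl⟩; positivity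
    · intro hx
      refine ⟨log (x / m) / 2, ?_⟩
      rw [mul_div_cancel₀ _ two_ne_zero, exp_log (by positivity)]
      field_simp
  have h2 := integral_image_eq_integral_abs_deriv_smul MeasurableSet.univ hd hi
    (fun x => √(l / (2 * π * x ^ 3)) * exp (-(l * (x - m) ^ 2 / (2 * m ^ 2 * x))))
  rw [him] at h2
  rw [h2, Measure.restrict_univ]
  have hk : 0 < l / m := by positivity
  have : ∀ t : ℝ, |m * (exp (2 * t) * 2)| • (√(l / (2 * π * (m * exp (2 * t)) ^ 3)) *
      exp (-(l * (m * exp (2 * t) - m) ^ 2 / (2 * m ^ 2 * (m * exp (2 * t))))))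
      = (2 * √((l / m) / (2 * π))) * (exp (-t) * exp (-(2 * (l / m)) * sinh t ^ 2)) := by
    intro t
    have e2 : exp (2 * t) = exp t ^ 2 := by rw [← exp_nat_mul]; norm_num
    have hE := exp_pos t
    rw [abs_of_pos (by positivity), e2, smul_eq_mul]
    have hs : √(l / (2 * π * (m * exp t ^ 2) ^ 3)) = √((l / m) / (2 * π)) / (m * exp t ^ 3) := by
      rw [eq_div_iff (by positivity), ← sqrt_sq (show 0 ≤ m * exp t ^ 3 by positivity),
        ← sqrt_mul (by positivity)]
      congr 1; field_simp
    have he : -(l * (m * exp t ^ 2 - m) ^ 2 / (2 * m ^ 2 * (m * exp t ^ 2)))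
        = -(2 * (l / m)) * sinh t ^ 2 := by
      rw [Real.sinh_eq, exp_neg]; field_simp
    rw [hs, he, exp_neg]; field_simp
  simp only [this]
  rw [integral_const_mul, ig_exp _ hk, mul_assoc, ← sqrt_mul (by positivity)]
  have : l / m / (2 * π) * (π / (2 * (l / m))) = (1 / 2) ^ 2 := by
    field_simp
  rw [this, sqrt_sq (by norm_num)]; norm_num

/-- the inverse Gaussian density integrates against `exp(-c·x)` to
`exp((λ/μ)(1 - √(1 + 2μ²c/λ)))`; in particular (`c = 0`) it is a probability density. -/
theorem inverse_gaussian_laplace_transform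
    (μ l : ℝ) (hμ : 0 < μ) (hl : 0 < l)
    (f : ℝ → ℝ)
    (hf : ∀ x : ℝ, f x = if 0 < x then
        Real.sqrt (l / (2 * Real.pi * x ^ 3)) * Real.exp (-(l * (x - μ) ^ 2 / (2 * μ ^ 2 * x)))
      else 0) :
    ∀ c : ℝ, 0 ≤ c →
      (∫ x : ℝ, Real.exp (-(c * x)) * f x)
        = Real.exp ((l / μ) * (1 - Real.sqrt (1 + 2 * μ ^ 2 * c / l))) ∧
      (∫ x : ℝ, f x) = 1 := by
  have key : ∀ g : ℝ → ℝ, (∫ x : ℝ, g x * f x) = ∫ x in Ioi (0:ℝ), g x *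
      (√(l / (2 * π * x ^ 3)) * exp (-(l * (x - μ) ^ 2 / (2 * μ ^ 2 * x)))) := by
    intro g
    rw [← integral_indicator measurableSet_Ioi]
    congr 1; ext x
    rw [hf, indicator_apply]
    simp only [mem_Ioi]
    split_ifs <;> simp
  intro c hc
  constructor
  · rw [key]
    set s := √(1 + 2 * μ ^ 2 * c / l) with hs
    have hspos : 0 < s := sqrt_pos.2 (by positivity)
    have hs2 : s ^ 2 = 1 + 2 * μ ^ 2 * c / l := sq_sqrt (by positivity)
    have hc' : c = l * (s ^ 2 - 1) / (2 * μ ^ 2) := by rw [hs2]; field_simp; ring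
    have h1 := ig_one (μ / s) l (by positivity) hl
    refine Eq.trans ?_ (mul_one (exp (l / μ * (1 - s))))
    refine Eq.trans ?_ (congrArg (fun z => exp (l / μ * (1 - s)) * z) h1)
    beta_reduce
    rw [← integral_const_mul]
    refine setIntegral_congr_fun measurableSet_Ioi fun x hx => ?_
    have hx' : 0 < x := hx
    rw [mul_left_comm, mul_left_comm (exp (l / μ * (1 - s))), ← exp_add, ← exp_add]
    congr 2
    clear_value s
    rw [hc']; field_simp; ring
  · have := key (fun _ => 1)
    simp only [one_mul] at this
    rw [this, ig_one μ l hμ hl]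
end

section
/- Let μ > 0 and λ > 0, let U be a random variable whose law has Lebesgue density √(λ/(2π·x³))·exp(−λ·(x−μ)²/(2μ²·x)) on (0,∞) (the inverse Gaussian distribution IG(μ,λ)), let Λ : [0,∞) → [0,∞) be measurable, and let T be a nonnegative random variable whose conditional survival given U is exp(−U·Λ(t)), i.e., P(T ≥ t, U ∈ B) = E[1_B(U)·exp(−U·Λ(t))] for every t ≥ 0 and Borel B ⊆ ℝ. Then for every t ≥ 0, P(T ≥ t) > 0 and E[U | T ≥ t] = μ/√(1 + 2μ²·Λ(t)/λ). -/
open MeasureTheory Real Set Filter Topology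

lemma ig_pointwise (μ l c ν x : ℝ) (hμ : 0 < μ) (hl : 0 < l) (hν : 0 < ν)
    (h : l / ν ^ 2 = l / μ ^ 2 + 2 * c) (hx : 0 < x) :
    (ν ^ 2 / x ^ 2) * ((ν ^ 2 / x) * (Real.sqrt (l / (2 * Real.pi * (ν ^ 2 / x) ^ 3)) *
      Real.exp (-(l * ((ν ^ 2 / x) - μ) ^ 2 / (2 * μ ^ 2 * (ν ^ 2 / x)))) *
        Real.exp (-((ν ^ 2 / x) * c)))) =
    ν * (Real.sqrt (l / (2 * Real.pi * x ^ 3)) *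
      Real.exp (-(l * (x - μ) ^ 2 / (2 * μ ^ 2 * x))) * Real.exp (-(x * c))) := by
  have h1 : Real.sqrt (l / (2 * Real.pi * (ν ^ 2 / x) ^ 3))
      = Real.sqrt (l / (2 * Real.pi * x ^ 3)) * (x ^ 3 / ν ^ 3) := by
    rw [← Real.sqrt_sq (show 0 ≤ x ^ 3 / ν ^ 3 by positivity), ← Real.sqrt_mul (by positivity)]
    congr 1
    have := Real.pi_pos
    field_simp
  have hc : c = (l / ν ^ 2 - l / μ ^ 2) / 2 := by linarith
  have h2 : -(l * ((ν ^ 2 / x) - μ) ^ 2 / (2 * μ ^ 2 * (ν ^ 2 / x))) + -((ν ^ 2 / x) * c)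
      = -(l * (x - μ) ^ 2 / (2 * μ ^ 2 * x)) + -(x * c) := by
    rw [hc]
    field_simp
    ring
  rw [mul_assoc (Real.sqrt _), mul_assoc (Real.sqrt _), ← Real.exp_add, ← Real.exp_add, h2, h1]
  field_simp

lemma ig_lintegral (μ l c ν : ℝ) (hμ : 0 < μ) (hl : 0 < l) (hν : 0 < ν)
    (h : l / ν ^ 2 = l / μ ^ 2 + 2 * c) (F : ℝ → ℝ)
    (hF : ∀ x, 0 < x → F x = Real.sqrt (l / (2 * Real.pi * x ^ 3)) *
      Real.exp (-(l * (x - μ) ^ 2 / (2 * μ ^ 2 * x))) * Real.exp (-(x * c))) :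
    ∫⁻ x in Ioi (0:ℝ), ENNReal.ofReal (x * F x)
      = ENNReal.ofReal ν * ∫⁻ x in Ioi (0:ℝ), ENNReal.ofReal (F x) := by
  have him : (fun x : ℝ => ν ^ 2 / x) '' Ioi 0 = Ioi 0 := by
    ext y
    simp only [mem_image, mem_Ioi]
    constructor
    · rintro ⟨x, hx, rfl⟩
      positivity
    · intro hy
      exact ⟨ν ^ 2 / y, by positivity, by field_simp⟩
  have hinj : InjOn (fun x : ℝ => ν ^ 2 / x) (Ioi 0) := by
    intro x hx y hy hxy
    simp only [mem_Ioi] at hx hy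
    simp only at hxy
    field_simp at hxy
    exact hxy.symm
  have hd : ∀ x ∈ Ioi (0:ℝ), HasDerivWithinAt (fun x : ℝ => ν ^ 2 / x) (-(ν ^ 2 / x ^ 2)) (Ioi 0) x := by
    intro x hx
    have hx0 : x ≠ 0 := ne_of_gt hx
    have := ((hasDerivAt_inv hx0).const_mul (ν ^ 2)).hasDerivWithinAt (s := Ioi 0)
    simpa [div_eq_mul_inv] using this
  have key := lintegral_image_eq_lintegral_abs_deriv_mul measurableSet_Ioi hd hinj
    (fun x => ENNReal.ofReal (x * F x))
  rw [him] at key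
  rw [key, ← lintegral_const_mul' _ _ ENNReal.ofReal_ne_top]
  refine setLIntegral_congr_fun measurableSet_Ioi ?_
  intro x hx
  have hx : 0 < x := hx
  have hp : 0 < ν ^ 2 / x := by positivity
  simp only
  rw [abs_neg, abs_of_pos (by positivity), ← ENNReal.ofReal_mul (by positivity),
    ← ENNReal.ofReal_mul hν.le, hF _ hp, hF _ hx, ig_pointwise μ l c ν x hμ hl hν h hx]

/-- with inverse Gaussian `IG(μ,λ)` frailty and conditional survival
`exp(-U·Λ(t))`, survival has positive probability and the expected frailty among survivors
is `μ/√(1 + 2μ²Λ(t)/λ)`. -/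
theorem inverse_gaussian_frailty_cond_expectation
    {Ω : Type*} [MeasurableSpace Ω] (P : Measure Ω) [IsProbabilityMeasure P]
    (μ l : ℝ) (hμ : 0 < μ) (hl : 0 < l)
    (f : ℝ → ℝ)
    (hf : ∀ x : ℝ, f x = if 0 < x then
        Real.sqrt (l / (2 * Real.pi * x ^ 3)) * Real.exp (-(l * (x - μ) ^ 2 / (2 * μ ^ 2 * x)))
      else 0)
    (U : Ω → ℝ) (hU : Measurable U)
    (hlaw : P.map U = volume.withDensity (fun x => ENNReal.ofReal (f x)))
    (Λ : ℝ → ℝ) (hΛ : Measurable Λ) (hΛnn : ∀ s, 0 ≤ Λ s)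
    (T : Ω → ℝ) (hT : Measurable T) (hTnn : ∀ ω, 0 ≤ T ω)
    (hsurv : ∀ s : ℝ, 0 ≤ s → ∀ B : Set ℝ, MeasurableSet B →
      (P {ω | s ≤ T ω ∧ U ω ∈ B}).toReal
        = ∫ ω, B.indicator (fun _ => (1:ℝ)) (U ω) * Real.exp (-(U ω * Λ s)) ∂P) :
    ∀ t : ℝ, 0 ≤ t →
      0 < P {ω | t ≤ T ω} ∧
      (∫ ω in {ω | t ≤ T ω}, U ω ∂P) / (P {ω | t ≤ T ω}).toReal
        = μ / Real.sqrt (1 + 2 * μ ^ 2 * Λ t / l) := by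
  intro t ht
  have hc := hΛnn t
  set c := Λ t with hcdef
  set ν := μ / Real.sqrt (1 + 2 * μ ^ 2 * c / l) with hνdef
  have hq : 0 < 1 + 2 * μ ^ 2 * c / l := by positivity
  have hν : 0 < ν := by positivity
  have hνl : l / ν ^ 2 = l / μ ^ 2 + 2 * c := by
    rw [hνdef, div_pow, Real.sq_sqrt hq.le]
    field_simp
  have hfm : Measurable f := by
    have : f = fun x => if 0 < x then
        Real.sqrt (l / (2 * Real.pi * x ^ 3)) * Real.exp (-(l * (x - μ) ^ 2 / (2 * μ ^ 2 * x)))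
      else 0 := funext hf
    rw [this]
    exact Measurable.ite measurableSet_Ioi (by fun_prop) measurable_const
  have hf0 : ∀ x, x ≤ 0 → f x = 0 := fun x hx => by rw [hf, if_neg (not_lt.mpr hx)]
  have hfnn : ∀ x, 0 ≤ f x := fun x => by
    rw [hf]; split_ifs <;> positivity
  have hposlaw : ∀ᵐ x ∂(P.map U), 0 < x := by
    rw [hlaw, ae_withDensity_iff (by fun_prop)]
    refine Eventually.of_forall fun x hx => ?_
    by_contra hn
    exact hx (by simp [hf0 x (not_lt.mp hn)])
  have hpos : ∀ᵐ ω ∂P, 0 < U ω := ae_of_ae_map hU.aemeasurable hposlaw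
  have hA : MeasurableSet {ω | t ≤ T ω} := measurableSet_le measurable_const hT
  have hexpint : Integrable (fun ω => Real.exp (-(U ω * c))) P := by
    refine Integrable.of_bound (by fun_prop) 1 ?_
    filter_upwards [hpos] with ω hω
    rw [Real.norm_eq_abs, abs_of_pos (Real.exp_pos _)]
    exact Real.exp_le_one_iff.mpr (by nlinarith [mul_nonneg hω.le hc])
  have hZ : (P {ω | t ≤ T ω}).toReal = ∫ ω, Real.exp (-(U ω * c)) ∂P := by
    have := hsurv t ht univ MeasurableSet.univ
    simpa using this
  have hZpos : 0 < (P {ω | t ≤ T ω}).toReal := by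
    rw [hZ]
    exact integral_exp_pos hexpint
  have hmeas : (P.restrict {ω | t ≤ T ω}).map U
      = volume.withDensity (fun x => ENNReal.ofReal (f x * Real.exp (-(x * c)))) := by
    ext B hB
    rw [Measure.map_apply hU hB, Measure.restrict_apply (hU hB), withDensity_apply _ hB]
    have h1 : U ⁻¹' B ∩ {ω | t ≤ T ω} = {ω | t ≤ T ω ∧ U ω ∈ B} := by
      ext ω; simp [and_comm]
    have hi : Integrable (fun ω => B.indicator (fun _ => (1:ℝ)) (U ω) * Real.exp (-(U ω * c))) P := by
      have := hexpint.indicator (hU hB)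
      refine this.congr (Eventually.of_forall fun ω => ?_)
      by_cases hω : U ω ∈ B <;> simp [hω]
    rw [h1, ← ENNReal.ofReal_toReal (measure_ne_top P _), hsurv t ht B hB,
      ofReal_integral_eq_lintegral_ofReal hi (Eventually.of_forall fun ω =>
        mul_nonneg (indicator_nonneg (fun _ _ => zero_le_one) _) (Real.exp_pos _).le)]
    have hm : Measurable (fun x => ENNReal.ofReal (B.indicator (fun _ => (1:ℝ)) x * Real.exp (-(x * c)))) := by
      have : Measurable (B.indicator (fun _ => (1:ℝ))) := measurable_const.indicator hB
      fun_prop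
    rw [← lintegral_map (f := fun x => ENNReal.ofReal (B.indicator (fun _ => (1:ℝ)) x * Real.exp (-(x * c)))) hm hU,
      hlaw, lintegral_withDensity_eq_lintegral_mul _ (by fun_prop) hm, ← lintegral_indicator hB]
    refine lintegral_congr fun x => ?_
    by_cases hx : x ∈ B <;> simp [hx, ENNReal.ofReal_mul (hfnn x)]
  have hred : ∀ g : ℝ → ℝ, Measurable g → ∫⁻ ω in {ω | t ≤ T ω}, ENNReal.ofReal (g (U ω)) ∂P
      = ∫⁻ x in Ioi (0:ℝ), ENNReal.ofReal (g x * (f x * Real.exp (-(x * c)))) := by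
    intro g hg
    rw [← lintegral_map (f := fun x => ENNReal.ofReal (g x)) (by fun_prop) hU, hmeas,
      lintegral_withDensity_eq_lintegral_mul _ (by fun_prop) (by fun_prop),
      ← lintegral_indicator measurableSet_Ioi]
    refine lintegral_congr fun x => ?_
    by_cases hx : 0 < x
    · have : 0 ≤ f x * Real.exp (-(x * c)) := mul_nonneg (hfnn x) (Real.exp_pos _).le
      simp [hx, mul_comm (g x), ENNReal.ofReal_mul this]
    · simp [hx, hf0 x (not_lt.mp hx)]
  have hkey := ig_lintegral μ l c ν hμ hl hν hνl (fun x => f x * Real.exp (-(x * c)))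
    (fun x hx => by simp only [hf x, if_pos hx])
  have hone := hred (fun _ => 1) measurable_const
  have hid := hred (fun x => x) measurable_id
  simp only [one_mul, ENNReal.ofReal_one, lintegral_one, Measure.restrict_apply_univ] at hone
  rw [hkey, ← hone] at hid
  refine ⟨(ENNReal.toReal_pos_iff.mp hZpos).1, ?_⟩
  rw [integral_eq_lintegral_of_nonneg_ae
    ((ae_restrict_of_ae hpos).mono fun ω h => h.le) hU.aestronglyMeasurable, hid,
    ENNReal.toReal_mul, ENNReal.toReal_ofReal hν.le]
  field_simp
end

section
/- Let U0 be a nonnegative integrable random variable with Laplace transform 𝓛(c) = E[exp(−c·U0)] and derivative 𝓛'(c) = −E[U0·exp(−c·U0)]. Let U1 be independent of U0 with the Benefit-Harm-Neutral distribution taking values μ1, μ2, μ3 = 1 (all μ_i > 0) with probabilities p1, p2, p3 = 1 − p1 − p2 respectively. Let Λ : [0,∞) → [0,∞) be measurable and let T be a nonnegative random variable whose conditional survival given (U0,U1) is exp(−U0·U1·Λ(t)), i.e., P(T ≥ t, (U0,U1) ∈ B) = E[1_B(U0,U1)·exp(−U0·U1·Λ(t))] for every t ≥ 0 and Borel B ⊆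 ℝ². Then for every t ≥ 0, P(T ≥ t) > 0 and E[U0·U1 | T ≥ t] = −(Σ_{i=1}^{3} p_i·μ_i·𝓛'(Λ(t)·μ_i)) / (Σ_{i=1}^{3} p_i·𝓛(Λ(t)·μ_i)). -/
open MeasureTheory Real Set Filter Topology
open scoped ENNReal

lemma bhn_aux_int {Ω : Type*} [MeasurableSpace Ω] (P : Measure Ω) [IsProbabilityMeasure P]
    (U0 U1 : Ω → ℝ) (hU0 : Measurable U0) (hU1 : Measurable U1)
    (μ1 μ2 p1 p2 : ℝ) 
    (hp1 : 0 ≤ p1) (hp2 : 0 ≤ p2) (hp : p1 + p2 ≤ 1)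
    (hU1law : P.map U1 = ENNReal.ofReal p1 • Measure.dirac μ1
        + ENNReal.ofReal p2 • Measure.dirac μ2
        + ENNReal.ofReal (1 - p1 - p2) • Measure.dirac (1 : ℝ))
    (hindep : ProbabilityTheory.IndepFun U0 U1 P)
    (h : ℝ × ℝ → ℝ) (hm : Measurable h)
    (h1 : Integrable (fun ω => h (U0 ω, μ1)) P) (h2 : Integrable (fun ω => h (U0 ω, μ2)) P)
    (h3 : Integrable (fun ω => h (U0 ω, 1)) P) :
    Integrable (fun ω => h (U0 ω, U1 ω)) P ∧ ∫ ω, h (U0 ω, U1 ω) ∂P =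
      p1 * ∫ ω, h (U0 ω, μ1) ∂P + p2 * ∫ ω, h (U0 ω, μ2) ∂P
        + (1 - p1 - p2) * ∫ ω, h (U0 ω, 1) ∂P := by
  have hmap : P.map (fun ω => (U0 ω, U1 ω)) =
      ENNReal.ofReal p1 • P.map (fun ω => (U0 ω, μ1))
        + ENNReal.ofReal p2 • P.map (fun ω => (U0 ω, μ2))
        + ENNReal.ofReal (1 - p1 - p2) • P.map (fun ω => (U0 ω, (1:ℝ))) := by
    have key : ∀ y : ℝ, (P.map U0).prod (Measure.dirac y) = P.map (fun ω => (U0 ω, y)) := by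
      intro y
      rw [Measure.prod_dirac, Measure.map_map (by fun_prop) hU0]
      rfl
    have := Measure.isProbabilityMeasure_map (μ := P) hU0.aemeasurable
    rw [(ProbabilityTheory.indepFun_iff_map_prod_eq_prod_map_map hU0.aemeasurable
      hU1.aemeasurable).1 hindep, hU1law, Measure.prod_add, Measure.prod_add,
      Measure.prod_smul_right, Measure.prod_smul_right, Measure.prod_smul_right, key, key, key]
  have i : ∀ y : ℝ, Integrable (fun ω => h (U0 ω, y)) P → ∀ c : ℝ,
      Integrable h (ENNReal.ofReal c • P.map (fun ω => (U0 ω, y))) := by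
    intro y hy c
    refine Integrable.smul_measure ?_ ENNReal.ofReal_ne_top
    exact (integrable_map_measure hm.aestronglyMeasurable (by fun_prop)).2 hy
  have e : ∀ y : ℝ, ∫ x, h x ∂(P.map (fun ω => (U0 ω, y))) = ∫ ω, h (U0 ω, y) ∂P := by
    intro y
    exact integral_map (by fun_prop) hm.aestronglyMeasurable
  have e0 : ∫ ω, h (U0 ω, U1 ω) ∂P = ∫ x, h x ∂(P.map (fun ω => (U0 ω, U1 ω))) :=
    (integral_map (by fun_prop) hm.aestronglyMeasurable).symm
  constructor
  · have : Integrable h (P.map (fun ω => (U0 ω, U1 ω))) := by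
      rw [hmap]
      exact ((i _ h1 _).add_measure (i _ h2 _)).add_measure (i _ h3 _)
    exact (integrable_map_measure hm.aestronglyMeasurable (by fun_prop)).1 this
  · rw [e0, hmap, integral_add_measure ((i _ h1 _).add_measure (i _ h2 _)) (i _ h3 _),
      integral_add_measure (i _ h1 _) (i _ h2 _), integral_smul_measure, integral_smul_measure,
      integral_smul_measure, e, e, e, ENNReal.toReal_ofReal hp1, ENNReal.toReal_ofReal hp2,
      ENNReal.toReal_ofReal (by linarith)]
    simp only [smul_eq_mul]

/-- with nonnegative integrable frailty `U0` (Laplace transform `L`, derivative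
`L'`), an independent Benefit-Harm-Neutral modifier `U1` with values `μ1, μ2, μ3 = 1` and
probabilities `p1, p2, p3 = 1 - p1 - p2`, and conditional survival `exp(-U0·U1·Λ(t))`,
survival has positive probability and
`E[U0·U1 | T ≥ t] = -(Σ pᵢμᵢ L'(Λ(t)μᵢ)) / (Σ pᵢ L(Λ(t)μᵢ))`. -/
theorem bhn_modifier_gamma_frailty_cond_expectation
    {Ω : Type*} [MeasurableSpace Ω] (P : Measure Ω) [IsProbabilityMeasure P]
    (U0 : Ω → ℝ) (hU0 : Measurable U0) (hU0nn : ∀ ω, 0 ≤ U0 ω) (hU0int : Integrable U0 P)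
    (L L' : ℝ → ℝ) (hL : ∀ c, L c = ∫ ω, Real.exp (-(c * U0 ω)) ∂P)
    (hL' : ∀ c, L' c = - ∫ ω, U0 ω * Real.exp (-(c * U0 ω)) ∂P)
    (μ1 μ2 p1 p2 : ℝ) (hμ1 : 0 < μ1) (hμ2 : 0 < μ2)
    (hp1 : 0 ≤ p1) (hp2 : 0 ≤ p2) (hp : p1 + p2 ≤ 1)
    (U1 : Ω → ℝ) (hU1 : Measurable U1)
    (hU1law : P.map U1 = ENNReal.ofReal p1 • Measure.dirac μ1
        + ENNReal.ofReal p2 • Measure.dirac μ2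
        + ENNReal.ofReal (1 - p1 - p2) • Measure.dirac (1 : ℝ))
    (hindep : ProbabilityTheory.IndepFun U0 U1 P)
    (Λ : ℝ → ℝ) (hΛ : Measurable Λ) (hΛnn : ∀ s, 0 ≤ Λ s)
    (T : Ω → ℝ) (hT : Measurable T) (hTnn : ∀ ω, 0 ≤ T ω)
    (hsurv : ∀ s : ℝ, 0 ≤ s → ∀ B : Set (ℝ × ℝ), MeasurableSet B →
      (P {ω | s ≤ T ω ∧ (U0 ω, U1 ω) ∈ B}).toReal
        = ∫ ω, B.indicator (fun _ => (1:ℝ)) (U0 ω, U1 ω)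
            * Real.exp (-(U0 ω * U1 ω * Λ s)) ∂P) :
    ∀ t : ℝ, 0 ≤ t →
      0 < P {ω | t ≤ T ω} ∧
      (∫ ω in {ω | t ≤ T ω}, U0 ω * U1 ω ∂P) / (P {ω | t ≤ T ω}).toReal
        = -(p1 * μ1 * L' (Λ t * μ1) + p2 * μ2 * L' (Λ t * μ2)
              + (1 - p1 - p2) * 1 * L' (Λ t * 1))
          / (p1 * L (Λ t * μ1) + p2 * L (Λ t * μ2) + (1 - p1 - p2) * L (Λ t * 1)) := by
  intro t ht
  have hexp : ∀ y : ℝ, 0 < y → Integrable (fun ω => Real.exp (-(U0 ω * y * Λ t))) P := by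
    intro y hy
    refine Integrable.of_bound (by fun_prop) 1 (ae_of_all _ fun ω => ?_)
    rw [Real.norm_eq_abs, abs_of_pos (Real.exp_pos _), Real.exp_le_one_iff]
    have := mul_nonneg (mul_nonneg (hU0nn ω) hy.le) (hΛnn t)
    linarith
  have hexp' : ∀ y : ℝ, 0 < y →
      Integrable (fun ω => U0 ω * y * Real.exp (-(U0 ω * y * Λ t))) P := by
    intro y hy
    refine (hU0int.mul_const y).mono (by fun_prop) (ae_of_all _ fun ω => ?_)
    rw [norm_mul]
    refine mul_le_of_le_one_right (norm_nonneg _) ?_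
    rw [Real.norm_eq_abs, abs_of_pos (Real.exp_pos _), Real.exp_le_one_iff]
    have := mul_nonneg (mul_nonneg (hU0nn ω) hy.le) (hΛnn t)
    linarith
  obtain ⟨if1, ef1⟩ := bhn_aux_int P U0 U1 hU0 hU1 μ1 μ2 p1 p2 hp1 hp2 hp hU1law hindep
    (fun x => Real.exp (-(x.1 * x.2 * Λ t))) (by fun_prop) (hexp _ hμ1) (hexp _ hμ2)
    (hexp _ one_pos)
  obtain ⟨if2, ef2⟩ := bhn_aux_int P U0 U1 hU0 hU1 μ1 μ2 p1 p2 hp1 hp2 hp hU1law hindep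
    (fun x => x.1 * x.2 * Real.exp (-(x.1 * x.2 * Λ t))) (by fun_prop) (hexp' _ hμ1)
    (hexp' _ hμ2) (hexp' _ one_pos)
  simp only at if1 ef1 if2 ef2
  have hA : MeasurableSet {ω | t ≤ T ω} := measurableSet_le measurable_const hT
  have hX : Measurable (fun ω => (U0 ω, U1 ω)) := by fun_prop
  have hPA : (P {ω | t ≤ T ω}).toReal = ∫ ω, Real.exp (-(U0 ω * U1 ω * Λ t)) ∂P := by
    have := hsurv t ht univ MeasurableSet.univ
    simpa using this
  have hLe : ∀ y : ℝ, ∫ ω, Real.exp (-(U0 ω * y * Λ t)) ∂P = L (Λ t * y) := by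
    intro y
    rw [hL]
    congr 1; ext ω; congr 1; ring
  have hLe' : ∀ y : ℝ, ∫ ω, U0 ω * y * Real.exp (-(U0 ω * y * Λ t)) ∂P
      = - (y * L' (Λ t * y)) := by
    intro y
    rw [hL', mul_neg, neg_neg, ← integral_const_mul]
    congr 1; ext ω
    rw [show U0 ω * y * Λ t = Λ t * y * U0 ω by ring]; ring
  have hpos : 0 < (P {ω | t ≤ T ω}).toReal := by
    rw [hPA]
    exact integral_exp_pos if1
  refine ⟨(ENNReal.toReal_pos_iff.1 hpos).1, ?_⟩
  have hmeas : (P.restrict {ω | t ≤ T ω}).map (fun ω => (U0 ω, U1 ω)) =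
      (P.withDensity (fun ω => ENNReal.ofReal (Real.exp (-(U0 ω * U1 ω * Λ t))))).map
        (fun ω => (U0 ω, U1 ω)) := by
    ext B hB
    rw [Measure.map_apply hX hB, Measure.map_apply hX hB, Measure.restrict_apply (hX hB),
      withDensity_apply _ (hX hB), ← ofReal_integral_eq_lintegral_ofReal if1.integrableOn
        (ae_of_all _ fun ω => (Real.exp_pos _).le), ← integral_indicator (hX hB)]
    have h1 := hsurv t ht B hB
    rw [← ENNReal.ofReal_toReal (measure_ne_top P (_ ∩ _))]
    congr 1
    have hs : (fun ω => (U0 ω, U1 ω)) ⁻¹' B ∩ {ω | t ≤ T ω}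
        = {ω | t ≤ T ω ∧ (U0 ω, U1 ω) ∈ B} := by
      ext ω; simp [and_comm]
    rw [hs, h1]
    congr 1
    funext ω
    by_cases hω : (U0 ω, U1 ω) ∈ B <;> simp [Set.indicator, hω]
  have hnum : ∫ ω in {ω | t ≤ T ω}, U0 ω * U1 ω ∂P =
      ∫ ω, U0 ω * U1 ω * Real.exp (-(U0 ω * U1 ω * Λ t)) ∂P := by
    have hm : Measurable (fun x : ℝ × ℝ => x.1 * x.2) := by fun_prop
    have a := integral_map (μ := P.restrict {ω | t ≤ T ω}) hX.aemeasurable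
      hm.aestronglyMeasurable
    have b := integral_map (μ := P.withDensity
      (fun ω => ENNReal.ofReal (Real.exp (-(U0 ω * U1 ω * Λ t))))) hX.aemeasurable
      hm.aestronglyMeasurable
    rw [hmeas, b] at a
    rw [← a, integral_withDensity_eq_integral_toReal_smul (by fun_prop)
      (ae_of_all _ fun ω => ENNReal.ofReal_lt_top)]
    congr 1; ext ω
    rw [ENNReal.toReal_ofReal (Real.exp_pos _).le, smul_eq_mul, mul_comm]
  rw [hnum, hPA, ef1, ef2, hLe, hLe, hLe, hLe', hLe', hLe']
  congr 1
  ring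
end

section
/- Let θ > 0 and c > 0, and let U0 be a random variable distributed according to the gamma distribution with shape 1/θ and rate 1/θ (so E[U0] = 1 and Var(U0) = θ). Let T^1 be a nonnegative random variable whose conditional survival given U0 is exp(−c·U0·t³/60), and let T^0 be one whose conditional survival given U0 is exp(−U0·t³/60) (i.e., both worlds have baseline hazard λ0(t) = t²/20 and the causal hazard ratio is the constant c). Then for every t > 0 the marginal hazards of T^1 and T^0 at t exist, and the marginal causal hazard ratio satisfies λ_{T^1}(t)/λ_{T^0}(t) = 1 + 60·(c − 1)/(60 + c·t³·θ); moreover λ_{T^1}(t)/λ_{T^0}(t) → 1 as t → ∞. -/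
open MeasureTheory Real Set Filter Topology

lemma aux_laplace (k r y : ℝ) (hk : 0 < k) (hr : 0 < r) (hy : 0 ≤ y) :
    ∫ u, Real.exp (-(y * u)) ∂(ProbabilityTheory.gammaMeasure k r) = (r / (r + y)) ^ k := by
  have hry : 0 < r + y := by linarith
  unfold ProbabilityTheory.gammaMeasure
  rw [integral_withDensity_eq_integral_toReal_smul (f := ProbabilityTheory.gammaPDF k r)
    (ProbabilityTheory.measurable_gammaPDFReal k r).ennreal_ofReal
    (by simp [ProbabilityTheory.gammaPDF])]
  have h1 : (fun u : ℝ => (ProbabilityTheory.gammaPDF k r u).toReal • Real.exp (-(y * u)))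
      = (Ici (0:ℝ)).indicator
        (fun u => r ^ k / Real.Gamma k * (u ^ (k - 1) * Real.exp (-((r + y) * u)))) := by
    funext u
    rw [ProbabilityTheory.gammaPDF,
      ENNReal.toReal_ofReal (ProbabilityTheory.gammaPDFReal_nonneg hk hr u),
      ProbabilityTheory.gammaPDFReal]
    by_cases hu : 0 ≤ u
    · rw [indicator_of_mem (show u ∈ Ici (0:ℝ) from hu), if_pos hu, smul_eq_mul,
        show -((r + y) * u) = -(r * u) + -(y * u) by ring, Real.exp_add]
      ring
    · rw [indicator_of_notMem (show u ∉ Ici (0:ℝ) from hu), if_neg hu]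
      simp
  rw [h1, integral_indicator measurableSet_Ici, integral_Ici_eq_integral_Ioi,
    integral_const_mul, Real.integral_rpow_mul_exp_neg_mul_Ioi hk hry,
    Real.div_rpow hr.le hry.le, Real.div_rpow zero_le_one hry.le, Real.one_rpow]
  have := (Real.Gamma_pos_of_pos hk).ne'
  field_simp

lemma aux_hazard {Ω : Type*} [MeasurableSpace Ω] (P : Measure Ω) [IsProbabilityMeasure P]
    (θ a : ℝ) (hθ : 0 < θ) (ha : 0 < a)
    (U0 : Ω → ℝ) (hU0 : Measurable U0)
    (hlaw : P.map U0 = ProbabilityTheory.gammaMeasure (1 / θ) (1 / θ))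
    (T : Ω → ℝ) (hT : Measurable T)
    (hsurv : ∀ s : ℝ, 0 ≤ s → ∀ B : Set ℝ, MeasurableSet B →
      (P {ω | s ≤ T ω ∧ U0 ω ∈ B}).toReal
        = ∫ ω, B.indicator (fun _ => (1:ℝ)) (U0 ω)
            * Real.exp (-(a * U0 ω * s ^ 3 / 60)) ∂P) (t : ℝ) (ht : 0 < t) :
    Tendsto
          (fun h : ℝ => h⁻¹ * ((ProbabilityTheory.cond P {ω | t ≤ T ω})
              {ω | T ω ∈ Ico t (t + h)}).toReal)
          (𝓝[>] 0) (𝓝 (3 * a * t ^ 2 / (60 + a * t ^ 3 * θ))) := by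
  set S : ℝ → ℝ := fun s => ((60 + a * s ^ 3 * θ) / 60) ^ (-(1 / θ)) with hS
  have hsv : ∀ s : ℝ, 0 ≤ s → (P {ω | s ≤ T ω}).toReal = S s := by
    intro s hs
    have h1 := hsurv s hs univ MeasurableSet.univ
    simp only [mem_univ, and_true, indicator_univ, one_mul] at h1
    rw [h1]
    have h2 := aux_laplace (1 / θ) (1 / θ) (a * s ^ 3 / 60) (by positivity) (by positivity)
      (by positivity)
    rw [← hlaw, integral_map hU0.aemeasurable (by fun_prop)] at h2
    have h3 : (60 + a * s ^ 3 * θ) / 60 = (1 / θ / (1 / θ + a * s ^ 3 / 60))⁻¹ := by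
      field_simp
    have h4 : 0 ≤ (1 / θ / (1 / θ + a * s ^ 3 / 60)) := by positivity
    simp only [hS]
    rw [h3, Real.rpow_neg (inv_nonneg.2 h4), Real.inv_rpow h4, inv_inv, ← h2]
    congr 1
    funext ω
    congr 1
    ring
  have hpos : 0 < 60 + a * t ^ 3 * θ := by positivity
  have hSpos : 0 < S t := Real.rpow_pos_of_pos (by positivity) _
  have hd0 : HasDerivAt (fun s : ℝ => (60 + a * s ^ 3 * θ) / 60) (a * (3 * t ^ 2) * θ / 60) t := by
    have := ((((hasDerivAt_pow 3 t).const_mul a).mul_const θ).const_add 60).div_const 60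
    simpa using this
  have hd := hd0.rpow_const (p := -(1 / θ)) (Or.inl (by positivity))
  have hlim := hd.tendsto_slope_zero_right.neg.const_mul (S t)⁻¹
  have hval : (S t)⁻¹ * -(a * (3 * t ^ 2) * θ / 60 * -(1 / θ) *
      ((60 + a * t ^ 3 * θ) / 60) ^ (-(1 / θ) - 1)) = 3 * a * t ^ 2 / (60 + a * t ^ 3 * θ) := by
    rw [Real.rpow_sub_one (by positivity)]
    change (S t)⁻¹ * -(a * (3 * t ^ 2) * θ / 60 * -(1 / θ) *
      (S t / ((60 + a * t ^ 3 * θ) / 60))) = _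
    field_simp
  rw [hval] at hlim
  refine hlim.congr' ?_
  filter_upwards [self_mem_nhdsWithin] with h hh
  have hh : 0 < h := hh
  have hmeas : ∀ s : ℝ, MeasurableSet {ω | s ≤ T ω} := fun s => measurableSet_le measurable_const hT
  have hset : {ω | t ≤ T ω} ∩ {ω | T ω ∈ Ico t (t + h)} = {ω | t ≤ T ω} \ {ω | t + h ≤ T ω} := by
    ext ω
    simp only [mem_inter_iff, mem_setOf_eq, mem_Ico, mem_diff, not_le]
    tauto
  have hsub : {ω | t + h ≤ T ω} ⊆ {ω | t ≤ T ω} := by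
    intro ω hω
    simp only [mem_setOf_eq] at *
    linarith
  rw [ProbabilityTheory.cond_apply (hmeas t), hset, measure_diff hsub (hmeas _).nullMeasurableSet
    (measure_ne_top _ _), ENNReal.toReal_mul, ENNReal.toReal_inv,
    ENNReal.toReal_sub_of_le (measure_mono hsub) (measure_ne_top _ _), hsv t ht.le,
    hsv (t + h) (by linarith)]
  simp only [hS, smul_eq_mul]
  ring

/-- with gamma frailty `U0 ~ Γ(1/θ, 1/θ)` (mean 1, variance θ), baseline
cumulative hazard `t³/60` and constant causal hazard ratio `c`, the marginal hazards of
`T¹` and `T⁰` exist at every `t > 0`, their ratio equals `1 + 60(c-1)/(60 + c·t³·θ)`, and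
this marginal causal hazard ratio tends to `1` as `t → ∞`. -/
theorem gamma_frailty_mchr_formula_and_limit
    {Ω : Type*} [MeasurableSpace Ω] (P : Measure Ω) [IsProbabilityMeasure P]
    (θ c : ℝ) (hθ : 0 < θ) (hc : 0 < c)
    (U0 : Ω → ℝ) (hU0 : Measurable U0)
    (hlaw : P.map U0 = ProbabilityTheory.gammaMeasure (1 / θ) (1 / θ))
    (T1 T0 : Ω → ℝ) (hT1 : Measurable T1) (hT0 : Measurable T0)
    (hT1nn : ∀ ω, 0 ≤ T1 ω) (hT0nn : ∀ ω, 0 ≤ T0 ω)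
    (hsurv1 : ∀ s : ℝ, 0 ≤ s → ∀ B : Set ℝ, MeasurableSet B →
      (P {ω | s ≤ T1 ω ∧ U0 ω ∈ B}).toReal
        = ∫ ω, B.indicator (fun _ => (1:ℝ)) (U0 ω)
            * Real.exp (-(c * U0 ω * s ^ 3 / 60)) ∂P)
    (hsurv0 : ∀ s : ℝ, 0 ≤ s → ∀ B : Set ℝ, MeasurableSet B →
      (P {ω | s ≤ T0 ω ∧ U0 ω ∈ B}).toReal
        = ∫ ω, B.indicator (fun _ => (1:ℝ)) (U0 ω)
            * Real.exp (-(U0 ω * s ^ 3 / 60)) ∂P) :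
    ∃ lam1 lam0 : ℝ → ℝ,
      (∀ t : ℝ, 0 < t →
        Tendsto
          (fun h : ℝ => h⁻¹ * ((ProbabilityTheory.cond P {ω | t ≤ T1 ω})
              {ω | T1 ω ∈ Ico t (t + h)}).toReal)
          (𝓝[>] 0) (𝓝 (lam1 t)) ∧
        Tendsto
          (fun h : ℝ => h⁻¹ * ((ProbabilityTheory.cond P {ω | t ≤ T0 ω})
              {ω | T0 ω ∈ Ico t (t + h)}).toReal)
          (𝓝[>] 0) (𝓝 (lam0 t)) ∧
        lam1 t / lam0 t = 1 + 60 * (c - 1) / (60 + c * t ^ 3 * θ)) ∧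
      Tendsto (fun t : ℝ => lam1 t / lam0 t) atTop (𝓝 1) := by
  refine ⟨fun t => 3 * c * t ^ 2 / (60 + c * t ^ 3 * θ),
    fun t => 3 * 1 * t ^ 2 / (60 + 1 * t ^ 3 * θ), ?_⟩
  have hr : ∀ t : ℝ, 0 < t → 3 * c * t ^ 2 / (60 + c * t ^ 3 * θ) /
      (3 * 1 * t ^ 2 / (60 + 1 * t ^ 3 * θ)) = 1 + 60 * (c - 1) / (60 + c * t ^ 3 * θ) := by
    intro t ht
    have h1 : 0 < 60 + c * t ^ 3 * θ := by positivity
    have h2 : 0 < 60 + 1 * t ^ 3 * θ := by positivity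
    field_simp
    ring
  refine ⟨fun t ht => ⟨aux_hazard P θ c hθ hc U0 hU0 hlaw T1 hT1 hsurv1 t ht,
    aux_hazard P θ 1 hθ one_pos U0 hU0 hlaw T0 hT0 (by simpa only [one_mul] using hsurv0) t ht,
    hr t ht⟩, ?_⟩
  have hinf : Tendsto (fun t : ℝ => 60 + c * t ^ 3 * θ) atTop atTop :=
    tendsto_atTop_add_const_left _ _
      (((tendsto_pow_atTop (by norm_num)).const_mul_atTop hc).atTop_mul_const hθ)
  have hl := (hinf.const_div_atTop (60 * (c - 1))).const_add 1
  rw [add_zero] at hl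
  refine hl.congr' ?_
  filter_upwards [eventually_gt_atTop 0] with t ht
  exact (hr t ht).symm
end
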